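/- Let p be a prime, k ≥ 3 an integer, 0 < ε < 1, and δ = ε^{C_{p,k}}. Then for every positive integer n and all subsets X_1,…,X_k ⊆ F_p^n, at least one of the following holds: (a) the number of k-cycles (x_1,…,x_k) ∈ X_1×⋯×X_k is at least δ N^{k−1}; or (b) there exist subsets E_1 ⊆ X_1, …, E_k ⊆ X_k with |E_i| < εN for every i such that (X_1∖E_1)×⋯×(X_k∖E_k) contains no k-cycle. -/

import Mathlib

open scoped Classical

/-- The set of k-cycles in X 0 x ... x X (k-1): tuples with i-th coordinate in X i
summing to zero. -/
noncomputable def cycleSet {V : Type} [AddCommGroup V] [Fintype V] (k : ℕ)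
    (X : Fin k → Finset V) : Finset (Fin k → V) :=
  (Fintype.piFinset X).filter fun x => ∑ i, x i = 0

/-- The constant c_{p,3} ∈ (0,1), defined by
inf_{0<t<1} (t^0 + ... + t^(p-1)) / t^((p-1)/3) = p^(1 - c_{p,3}). -/
noncomputable def cp3 (p : ℕ) : ℝ :=
  1 - Real.logb p (sInf ((fun t : ℝ =>
    (∑ j ∈ Finset.range p, t ^ j) / t ^ (((p : ℝ) - 1) / 3)) '' Set.Ioo 0 1))

/-- The constant C_{p,k} = (k-2)/c_{p,3} + 1. -/
noncomputable def Cconst (p k : ℕ) : ℝ := ((k : ℝ) - 2) / cp3 p + 1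

section SliceRank

variable {F I α β γ : Type*} [Field F] [Fintype I]

/-- Fewer linear conditions than available coordinates leave a nonzero solution. -/
lemma exists_ne_zero_orthogonal (A : Finset α) (a : α → I → F) (Z : Finset I)
    (h : A.card < Z.card) :
    ∃ q : I → F, q ≠ 0 ∧ (∀ i ∉ Z, q i = 0) ∧ ∀ x ∈ A, ∑ i, q i * a x i = 0 := by
  let f : (Z → F) →ₗ[F] (A → F) := Matrix.mulVecLin (Matrix.of fun (x : A) (i : Z) => a x i)
  have hf : LinearMap.ker f ≠ ⊥ := LinearMap.ker_ne_bot_of_finrank_lt (by simpa using h)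
  obtain ⟨w, hw, hw0⟩ := Submodule.exists_mem_ne_zero_of_ne_bot hf
  refine ⟨fun i => if hi : i ∈ Z then w ⟨i, hi⟩ else 0, ?_, ?_, ?_⟩
  · contrapose! hw0
    funext i
    simpa using congrFun hw0 i
  · intro i hi
    simp [hi]
  · intro x hx
    have := congrFun (LinearMap.mem_ker.mp hw) ⟨x, hx⟩
    simp only [f, Matrix.mulVecLin_apply, Matrix.mulVec, dotProduct, Matrix.of_apply,
      Pi.zero_apply] at this
    refine Eq.trans ?_ this
    rw [← Finset.sum_subset (Finset.subset_univ Z), ← Finset.sum_coe_sort Z]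
    · refine Finset.sum_congr rfl fun i _ => ?_
      simp [mul_comm]
    · intro i _ hi
      simp [hi]

/-- A subspace of codimension at most `A.card` contains a vector of large support. -/
lemma exists_orthogonal_large_support (A : Finset α) (a : α → I → F) :
    ∃ h : I → F, (∀ x ∈ A, ∑ i, h i * a x i = 0) ∧
      Fintype.card I ≤ A.card + (Finset.univ.filter fun i => h i ≠ 0).card := by
  let P : ℕ → Prop := fun s => ∃ h : I → F, (∀ x ∈ A, ∑ i, h i * a x i = 0) ∧
    (Finset.univ.filter fun i => h i ≠ 0).card = s
  have hP : ∃ s, P s := ⟨_, 0, by simp, rfl⟩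
  have hb : ∀ s, P s → s ≤ Fintype.card I := by
    rintro s ⟨h, -, rfl⟩
    exact Finset.card_le_univ _
  obtain ⟨s, ⟨h, hh, hs⟩, hmax⟩ : ∃ s, P s ∧ ∀ t, P t → t ≤ s := by
    obtain ⟨s₀, hs₀⟩ := hP
    exact ⟨_, Nat.findGreatest_spec (hb _ hs₀) hs₀, fun t ht => Nat.le_findGreatest (hb t ht) ht⟩
  refine ⟨h, hh, ?_⟩
  by_contra! hlt
  let Z := Finset.univ.filter fun i => h i = 0
  have hZ : Z.card + (Finset.univ.filter fun i => h i ≠ 0).card = Fintype.card I := by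
    simpa using Finset.card_filter_add_card_filter_not (s := Finset.univ) fun i => h i = 0
  obtain ⟨q, hq0, hqZ, hq⟩ := exists_ne_zero_orthogonal A a Z (by omega)
  obtain ⟨i₀, hi₀⟩ := Function.ne_iff.mp hq0
  have hi₀Z : h i₀ = 0 := by
    by_contra hne
    exact hi₀ (hqZ _ (by simp [Z, hne]))
  have hle := hmax _ ⟨h + q, fun x hx => by simp [add_mul, Finset.sum_add_distrib, hh x hx, hq x hx],
    rfl⟩
  have hlt' : (Finset.univ.filter fun i => h i ≠ 0) ⊂
      Finset.univ.filter fun i => (h + q) i ≠ 0 := by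
    refine Finset.ssubset_iff_subset_ne.mpr ⟨fun i hi => ?_, fun heq => ?_⟩
    · have hi' : h i ≠ 0 := by simpa using hi
      simpa [hqZ i (by simp [Z, hi'])] using hi'
    · have : i₀ ∈ Finset.univ.filter fun i => h i ≠ 0 := by
        rw [heq]
        simpa [hi₀Z] using hi₀
      simp [hi₀Z] at this
  have := Finset.card_lt_card hlt'
  omega

/-- The slice rank of a diagonal tensor is the size of its index set. -/
lemma card_le_of_diagonal_eq_sum_slices (A : Finset α) (B : Finset β) (C : Finset γ)
    (a : α → I → F) (f : α → I → I → F) (b : β → I → F) (g : β → I → I → F)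
    (c : γ → I → F) (e : γ → I → I → F)
    (H : ∀ j k l, (if j = k ∧ k = l then (1 : F) else 0) =
      ∑ x ∈ A, a x j * f x k l + ∑ x ∈ B, b x k * g x j l + ∑ x ∈ C, c x l * e x j k) :
    Fintype.card I ≤ A.card + B.card + C.card := by
  by_contra! hlt
  obtain ⟨h, hA, hcard⟩ := exists_orthogonal_large_support A a
  obtain ⟨q, hq0, hqZ, hq⟩ := exists_ne_zero_orthogonal (B.disjSum C)
    (Sum.elim b fun x k => ∑ j, h j * e x j k) (Finset.univ.filter fun i => h i ≠ 0)
    (by rw [Finset.card_disjSum]; omega)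
  refine hq0 (funext fun l => ?_)
  have hB : ∀ x ∈ B, ∑ k, q k * b x k = 0 := fun x hx => hq (Sum.inl x) (by simpa using hx)
  have hC : ∀ x ∈ C, ∑ k, q k * ∑ j, h j * e x j k = 0 :=
    fun x hx => hq (Sum.inr x) (by simpa using hx)
  have h1 : ∑ k, ∑ j, q k * h j * (if j = k ∧ k = l then (1 : F) else 0) = q l * h l := by
    rw [Finset.sum_eq_single l, Finset.sum_eq_single l] <;> simp +contextual
  have h2 : ∑ k, ∑ j, q k * h j * (if j = k ∧ k = l then (1 : F) else 0) = 0 := by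
    simp only [H, mul_add, Finset.sum_add_distrib, Finset.mul_sum]
    have e1 : ∑ k, ∑ j, ∑ x ∈ A, q k * h j * (a x j * f x k l) = 0 := by
      refine Finset.sum_eq_zero fun k _ => ?_
      rw [Finset.sum_comm]
      refine Finset.sum_eq_zero fun x hx => ?_
      have : ∀ j, q k * h j * (a x j * f x k l) = (q k * f x k l) * (h j * a x j) :=
        fun j => by ring
      simp only [this, ← Finset.mul_sum, hA x hx, mul_zero]
    have e2 : ∑ k, ∑ j, ∑ x ∈ B, q k * h j * (b x k * g x j l) = 0 := by
      rw [Finset.sum_comm]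
      refine Finset.sum_eq_zero fun j _ => ?_
      rw [Finset.sum_comm]
      refine Finset.sum_eq_zero fun x hx => ?_
      have : ∀ k, q k * h j * (b x k * g x j l) = (h j * g x j l) * (q k * b x k) :=
        fun j => by ring
      simp only [this, ← Finset.mul_sum, hB x hx, mul_zero]
    have e3 : ∑ k, ∑ j, ∑ x ∈ C, q k * h j * (c x l * e x j k) = 0 := by
      simp_rw [Finset.sum_comm (s := (Finset.univ : Finset I)) (t := C)]
      refine Finset.sum_eq_zero fun x hx => ?_
      have : ∀ k j, q k * h j * (c x l * e x j k) = c x l * (q k * (h j * e x j k)) :=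
        fun k j => by ring
      simp only [this, ← Finset.mul_sum, hC x hx, mul_zero]
    rw [e1, e2, e3]
    simp
  rcases mul_eq_zero.mp (h1.symm.trans h2) with h0 | h0
  · exact h0
  · exact hqZ l (by simp [h0])

end SliceRank

section SumFree

/-- Exponent vectors of monomials with small individual degrees and total degree at most
`(p - 1) * d / 3`. -/
noncomputable def lowDegree (p d : ℕ) : Finset (Fin d → ℕ) :=
  (Fintype.piFinset fun _ => Finset.range p).filter fun α => 3 * ∑ i, α i ≤ (p - 1) * d

lemma card_lowDegree_le (p d : ℕ) (hp : 1 ≤ p) {t : ℝ} (ht0 : 0 < t) (ht1 : t < 1) :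
    ((lowDegree p d).card : ℝ) ≤
      ((∑ j ∈ Finset.range p, t ^ j) / t ^ (((p : ℝ) - 1) / 3)) ^ d := by
  have hs : 0 < t ^ (((p : ℝ) - 1) / 3) := Real.rpow_pos_of_pos ht0 _
  have hexp : ((∑ j ∈ Finset.range p, t ^ j) / t ^ (((p : ℝ) - 1) / 3)) ^ d =
      ∑ α ∈ Fintype.piFinset fun _ : Fin d => Finset.range p,
        ∏ i, t ^ α i / t ^ (((p : ℝ) - 1) / 3) := by
    rw [Finset.sum_div, Finset.sum_prod_piFinset (Finset.range p) fun (_ : Fin d) (j : ℕ) =>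
      t ^ j / t ^ (((p : ℝ) - 1) / 3)]
    simp
  rw [hexp, Finset.card_eq_sum_ones, Nat.cast_sum]
  refine (Finset.sum_le_sum fun α hα => ?_).trans
    (Finset.sum_le_sum_of_subset_of_nonneg (Finset.filter_subset _ _) fun α _ _ =>
      Finset.prod_nonneg fun i _ => by positivity)
  have hα' : 3 * ∑ i, α i ≤ (p - 1) * d := (Finset.mem_filter.mp hα).2
  have hα'' : 3 * ((∑ i, α i : ℕ) : ℝ) ≤ ((p : ℝ) - 1) * d := by
    have h := (Nat.cast_le (α := ℝ)).mpr hα'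
    push_cast [Nat.cast_sub hp] at h ⊢
    exact h
  rw [Finset.prod_div_distrib, Finset.prod_const, Finset.prod_pow_eq_pow_sum, Nat.cast_one,
    Finset.card_univ, Fintype.card_fin, one_le_div (by positivity), ← Real.rpow_mul_natCast ht0.le,
    ← Real.rpow_natCast t]
  exact Real.rpow_le_rpow_of_exponent_ge ht0 ht1.le (by linarith)

variable {p d : ℕ} [Fact p.Prime]

lemma prod_one_sub_pow_eq_ite (z : Fin d → ZMod p) :
    ∏ i, (1 - z i ^ (p - 1)) = if z = 0 then 1 else 0 := by
  have hp : p - 1 ≠ 0 := by have := (Fact.out : p.Prime).two_le; omega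
  split_ifs with h
  · simp [h, hp]
  · obtain ⟨i, hi⟩ := Function.ne_iff.mp h
    exact Finset.prod_eq_zero (Finset.mem_univ i) (by simp [ZMod.pow_card_sub_one_eq_one hi])

/-- Expansion of the indicator function of `x 0 + x 1 + x 2 = 0` into monomials. -/
lemma exists_monomial_expansion (p d : ℕ) [Fact p.Prime] :
    ∃ (P : Finset (Fin d → Fin 3 → ℕ)) (K : (Fin d → Fin 3 → ℕ) → ZMod p),
      (∀ τ ∈ P, ∃ s, (fun i => τ i s) ∈ lowDegree p d) ∧
      ∀ x : Fin 3 → Fin d → ZMod p, (if ∑ s, x s = 0 then (1 : ZMod p) else 0) =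
        ∑ τ ∈ P, K τ * ∏ s, ∏ i, x s i ^ τ i s := by
  have hp := (Fact.out : p.Prime).two_le
  let Q := Finset.piAntidiag (Finset.univ : Finset (Fin 3)) (p - 1)
  let coef : (Fin 3 → ℕ) → ZMod p := fun k =>
    (if k = 0 then 1 else 0) - if k ∈ Q then (Nat.multinomial Finset.univ k : ZMod p) else 0
  have hQ : ∀ k ∈ insert 0 Q, ∑ s, k s ≤ p - 1 := by
    intro k hk
    rcases Finset.mem_insert.mp hk with rfl | hk
    · simp
    · exact ((Finset.mem_piAntidiag.mp hk).1).le
  refine ⟨Fintype.piFinset fun _ => insert 0 Q, fun τ => ∏ i, coef (τ i), ?_, ?_⟩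
  · intro τ hτ
    have hτ' : ∀ i, ∑ s, τ i s ≤ p - 1 := fun i => hQ _ (Fintype.mem_piFinset.mp hτ i)
    have htot : ∑ s, ∑ i, τ i s ≤ (p - 1) * d := by
      rw [Finset.sum_comm]
      refine (Finset.sum_le_sum fun i _ => hτ' i).trans ?_
      simp [mul_comm]
    have hlt : ∀ s i, τ i s < p := fun s i => by
      have := (Finset.single_le_sum (f := fun s => τ i s) (fun _ _ => Nat.zero_le _)
        (Finset.mem_univ s)).trans (hτ' i)
      omega
    by_contra! hcon
    have h3 : ∀ s, (p - 1) * d < 3 * ∑ i, τ i s := fun s => by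
      by_contra! hle
      exact hcon s (Finset.mem_filter.mpr ⟨by simpa using hlt s, hle⟩)
    have h0 := h3 0
    have h1 := h3 1
    have h2 := h3 2
    rw [Fin.sum_univ_three] at htot
    omega
  · intro x
    have hone : ∀ i, 1 - (∑ s, x s) i ^ (p - 1) =
        ∑ k ∈ insert 0 Q, coef k * ∏ s, x s i ^ k s := by
      intro i
      rw [Finset.sum_apply, Finset.sum_pow_eq_sum_piAntidiag]
      simp only [coef, sub_mul, Finset.sum_sub_distrib]
      congr 1
      · rw [Finset.sum_eq_single 0] <;> simp +contextual
      · rw [Finset.sum_insert_of_eq_zero_if_notMem (fun h => by simp [h])]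
        exact Finset.sum_congr rfl fun k hk => by simp [Q, hk]
    rw [← prod_one_sub_pow_eq_ite]
    simp only [hone, Finset.prod_univ_sum]
    refine Finset.sum_congr rfl fun τ _ => ?_
    rw [Finset.prod_mul_distrib, Finset.prod_comm]

/-- The tricoloured sum-free theorem of Ellenberg–Gijswijt type. -/
lemma card_le_of_tricolored_sum_free {I : Type*} [Fintype I] (u v w : I → Fin d → ZMod p)
    (h : ∀ j k l, u j + v k = w l ↔ j = k ∧ k = l) :
    Fintype.card I ≤ 3 * (lowDegree p d).card := by
  obtain ⟨P, K, hP, hK⟩ := exists_monomial_expansion p d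
  choose! cls hcls using hP
  let mon : (Fin d → ℕ) → (Fin d → ZMod p) → ZMod p := fun α x => ∏ i, x i ^ α i
  let L := lowDegree p d
  have key := card_le_of_diagonal_eq_sum_slices L L L
    (fun α j => mon α (u j))
    (fun α k l => ∑ τ ∈ (P.filter fun τ => cls τ = 0) with (fun i => τ i 0) = α,
      K τ * mon (fun i => τ i 1) (v k) * mon (fun i => τ i 2) (-w l))
    (fun α k => mon α (v k))
    (fun α j l => ∑ τ ∈ (P.filter fun τ => cls τ = 1) with (fun i => τ i 1) = α,
      K τ * mon (fun i => τ i 0) (u j) * mon (fun i => τ i 2) (-w l))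
    (fun α l => mon α (-w l))
    (fun α j k => ∑ τ ∈ (P.filter fun τ => cls τ = 2) with (fun i => τ i 2) = α,
      K τ * mon (fun i => τ i 0) (u j) * mon (fun i => τ i 1) (v k))
    (fun j k l => ?_)
  · simp only [L] at key
    omega
  have hsum : ∀ (s : Fin 3) (f : (Fin d → ℕ) → ZMod p) (g : (Fin d → Fin 3 → ℕ) → ZMod p),
      ∑ α ∈ L, f α * ∑ τ ∈ (P.filter fun τ => cls τ = s) with (fun i => τ i s) = α, g τ =
      ∑ τ ∈ P.filter fun τ => cls τ = s, f (fun i => τ i s) * g τ := by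
    intro s f g
    rw [← Finset.sum_fiberwise_of_maps_to (s := P.filter fun τ => cls τ = s) (t := L)
      (g := fun τ i => τ i s)]
    · refine Finset.sum_congr rfl fun α _ => ?_
      rw [Finset.mul_sum]
      refine Finset.sum_congr rfl fun τ hτ => ?_
      rw [(Finset.mem_filter.mp hτ).2]
    · intro τ hτ
      obtain ⟨hτP, rfl⟩ := Finset.mem_filter.mp hτ
      exact hcls τ hτP
  rw [hsum 0, hsum 1, hsum 2, ← if_congr (h j k l) rfl rfl]
  have hx := hK ![u j, v k, -w l]
  have hz : (∑ s, ![u j, v k, -w l] s = 0) ↔ u j + v k = w l := by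
    rw [Fin.sum_univ_three]
    simp [← sub_eq_add_neg, sub_eq_zero]
  rw [if_congr hz rfl rfl] at hx
  rw [hx, ← Finset.sum_fiberwise P cls, Fin.sum_univ_three]
  congr 1
  · congr 1 <;>
    · refine Finset.sum_congr rfl fun τ _ => ?_
      simp only [Fin.prod_univ_three, mon]
      simp
      ring
  · refine Finset.sum_congr rfl fun τ _ => ?_
    simp only [Fin.prod_univ_three, mon]
    simp
    ring

end SumFree

section Exponent

variable {p : ℕ}

/-- The function minimised in the definition of `cp3`. -/
noncomputable def degreeBound (p : ℕ) (t : ℝ) : ℝ :=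
  (∑ j ∈ Finset.range p, t ^ j) / t ^ (((p : ℝ) - 1) / 3)

lemma one_le_degreeBound (hp : 1 ≤ p) {t : ℝ} (ht : t ∈ Set.Ioo (0 : ℝ) 1) :
    1 ≤ degreeBound p t := by
  obtain ⟨ht0, ht1⟩ := ht
  have hp' : (1 : ℝ) ≤ p := by exact_mod_cast hp
  have h1 : t ^ (((p : ℝ) - 1) / 3) ≤ 1 :=
    Real.rpow_le_one ht0.le ht1.le (by linarith)
  have h2 : (1 : ℝ) ≤ ∑ j ∈ Finset.range p, t ^ j := by
    have := Finset.single_le_sum (f := fun j => t ^ j) (fun j _ => by positivity)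
      (Finset.mem_range.mpr hp)
    simpa using this
  rw [degreeBound, one_le_div (Real.rpow_pos_of_pos ht0 _)]
  exact h1.trans h2

lemma bddBelow_degreeBound (hp : 1 ≤ p) : BddBelow (degreeBound p '' Set.Ioo 0 1) :=
  ⟨1, by rintro _ ⟨t, ht, rfl⟩; exact one_le_degreeBound hp ht⟩

lemma degreeBound_image_nonempty : (degreeBound p '' Set.Ioo 0 1).Nonempty :=
  Set.Nonempty.image _ ⟨1 / 2, by norm_num⟩

lemma one_le_sInf_degreeBound (hp : 1 ≤ p) : 1 ≤ sInf (degreeBound p '' Set.Ioo 0 1) :=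
  le_csInf degreeBound_image_nonempty (by rintro _ ⟨t, ht, rfl⟩; exact one_le_degreeBound hp ht)

lemma hasDerivAt_degreeBound_one (hp : 1 ≤ p) :
    HasDerivAt (degreeBound p) ((p : ℝ) * (((p : ℝ) - 1) / 6)) 1 := by
  have h1 : HasDerivAt (fun t : ℝ => ∑ j ∈ Finset.range p, t ^ j)
      (∑ j ∈ Finset.range p, (j : ℝ)) 1 := by
    have := HasDerivAt.fun_sum (u := Finset.range p) (A := fun j (t : ℝ) => t ^ j)
      (A' := fun j => (j : ℝ)) (x := 1) fun j _ => by simpa using hasDerivAt_pow j (1 : ℝ)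
    exact this
  have h2 : HasDerivAt (fun t : ℝ => t ^ (((p : ℝ) - 1) / 3)) (((p : ℝ) - 1) / 3) 1 := by
    simpa using Real.hasDerivAt_rpow_const (x := 1) (p := ((p : ℝ) - 1) / 3) (Or.inl one_ne_zero)
  have h3 := h1.fun_div h2 (by simp)
  have hs : (∑ j ∈ Finset.range p, (j : ℝ)) = p * (p - 1) / 2 := by
    have h := Finset.sum_range_id_mul_two p
    have h' : (((∑ j ∈ Finset.range p, j) * 2 : ℕ) : ℝ) = ((p * (p - 1) : ℕ) : ℝ) := by rw [h]
    push_cast [Nat.cast_sub hp] at h'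
    linarith
  refine HasDerivAt.congr_deriv (f := degreeBound p) h3 ?_
  simp [hs]
  ring

lemma sInf_degreeBound_lt (hp : 2 ≤ p) : sInf (degreeBound p '' Set.Ioo 0 1) < p := by
  have hp' : (2 : ℝ) ≤ p := by exact_mod_cast hp
  have hd := hasDerivAt_degreeBound_one (p := p) (by omega)
  have hslope := (hasDerivAt_iff_tendsto_slope.mp hd).eventually
    (lt_mem_nhds (show (0 : ℝ) < p * ((p - 1) / 6) by
      apply mul_pos <;> linarith))
  have hleft : ∀ᶠ t in nhdsWithin (1 : ℝ) (Set.Iio 1), 0 < slope (degreeBound p) 1 t :=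
    hslope.filter_mono (nhdsWithin_mono _ fun t ht => ne_of_lt ht)
  have hpos : ∀ᶠ t in nhdsWithin (1 : ℝ) (Set.Iio 1), 0 < t :=
    nhdsWithin_le_nhds (lt_mem_nhds one_pos)
  obtain ⟨t, ⟨hs, ht0⟩, ht1⟩ := ((hleft.and hpos).and self_mem_nhdsWithin).exists
  have ht1' : t < 1 := ht1
  have hone : degreeBound p 1 = p := by simp [degreeBound]
  rw [slope_def_field, hone] at hs
  have hlt : degreeBound p t < p := by
    by_contra! hle
    exact absurd hs (not_lt.mpr (div_nonpos_of_nonneg_of_nonpos (by linarith) (by linarith)))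
  exact (csInf_le (bddBelow_degreeBound (by omega)) ⟨t, ⟨ht0, ht1'⟩, rfl⟩).trans_lt hlt

lemma cp3_pos (hp : 2 ≤ p) : 0 < cp3 p := by
  have hp' : (1 : ℝ) < p := by exact_mod_cast hp
  have h1 := one_le_sInf_degreeBound (p := p) (by omega)
  have h := (Real.logb_lt_iff_lt_rpow hp' (by linarith)).mpr
    ((sInf_degreeBound_lt hp).trans_eq (Real.rpow_one _).symm)
  exact sub_pos.mpr h

lemma rpow_one_sub_cp3 (hp : 2 ≤ p) :
    (p : ℝ) ^ (1 - cp3 p) = sInf (degreeBound p '' Set.Ioo 0 1) := by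
  have hp' : (1 : ℝ) < p := by exact_mod_cast hp
  have h1 := one_le_sInf_degreeBound (p := p) (by omega)
  rw [cp3, sub_sub_cancel]
  exact Real.rpow_logb (by linarith) hp'.ne' (one_pos.trans_le h1)

lemma card_lowDegree_le_rpow (hp : 2 ≤ p) (d : ℕ) :
    ((lowDegree p d).card : ℝ) ≤ ((p : ℝ) ^ d) ^ (1 - cp3 p) := by
  rw [← Real.rpow_pow_comm (by positivity), rpow_one_sub_cp3 hp]
  have h1 := one_le_sInf_degreeBound (p := p) (by omega)
  rcases Nat.eq_zero_or_pos d with rfl | hd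
  · simpa using card_lowDegree_le p 0 (by omega) (t := 1 / 2) (by norm_num) (by norm_num)
  have hroot : ((lowDegree p d).card : ℝ) ^ (d : ℝ)⁻¹ ≤
      sInf (degreeBound p '' Set.Ioo 0 1) := by
    refine le_csInf degreeBound_image_nonempty ?_
    rintro _ ⟨t, ht, rfl⟩
    have h := Real.rpow_le_rpow (by positivity) (card_lowDegree_le p d (by omega) ht.1 ht.2)
      (inv_nonneg.mpr (Nat.cast_nonneg (α := ℝ) d))
    refine h.trans_eq ?_
    exact Real.pow_rpow_inv_natCast (zero_le_one.trans (one_le_degreeBound (by omega) ht)) hd.ne'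
  calc ((lowDegree p d).card : ℝ)
      = (((lowDegree p d).card : ℝ) ^ (d : ℝ)⁻¹) ^ d :=
        (Real.rpow_inv_natCast_pow (by positivity) hd.ne').symm
    _ ≤ _ := pow_le_pow_left₀ (by positivity) hroot d

end Exponent

section Minimizer

variable {α : Type*} {T : Finset α → ℕ} {A : ℕ}

lemma exists_minimizer {C : Finset α} (hC : C.Nonempty) (T : Finset α → ℕ) (A : ℕ) :
    ∃ J ⊆ C, J.Nonempty ∧ ∀ J' ⊆ C, J'.Nonempty → T J * J'.card ^ A ≤ T J' * J.card ^ A := by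
  obtain ⟨J, hJ, hmin⟩ := Finset.exists_min_image (C.powerset.filter (·.Nonempty))
    (fun J => (T J : ℝ) / (J.card : ℝ) ^ A) ⟨C, by simp [hC]⟩
  simp only [Finset.mem_filter, Finset.mem_powerset] at hJ hmin
  refine ⟨J, hJ.1, hJ.2, fun J' hJ' hne => ?_⟩
  have h1 : (0 : ℝ) < (J.card : ℝ) ^ A := pow_pos (by exact_mod_cast hJ.2.card_pos) _
  have h2 : (0 : ℝ) < (J'.card : ℝ) ^ A := pow_pos (by exact_mod_cast hne.card_pos) _
  have h := hmin J' ⟨hJ', hne⟩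
  rw [div_le_div_iff₀ h1 h2] at h
  exact_mod_cast h

lemma degree_le_of_minimizer [DecidableEq α] (hA : 1 ≤ A) {J : Finset α}
    (hmin : ∀ J' ⊆ J, J'.Nonempty → T J * J'.card ^ A ≤ T J' * J.card ^ A)
    {c : α} (hc : c ∈ J) {D : ℕ} (hD : T (J.erase c) + D ≤ T J) :
    D * J.card ≤ A * T J := by
  rcases Finset.eq_empty_or_nonempty (J.erase c) with he | hne
  · have : J.card = 1 := by
      have h1 := Finset.card_erase_of_mem hc
      have h2 := Finset.card_pos.mpr ⟨c, hc⟩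
      rw [he, Finset.card_empty] at h1
      omega
    rw [this]
    nlinarith
  have h := hmin _ (Finset.erase_subset c J) hne
  have hm : 0 < J.card := Finset.card_pos.mpr ⟨c, hc⟩
  have hcard : ((J.erase c).card : ℝ) = J.card - 1 := by
    rw [Finset.card_erase_of_mem hc, Nat.cast_sub hm, Nat.cast_one]
  have hm' : (1 : ℝ) ≤ J.card := by exact_mod_cast hm
  have h' : (T J : ℝ) * ((J.card : ℝ) - 1) ^ A ≤ T (J.erase c) * (J.card : ℝ) ^ A := by
    rw [← hcard]
    exact_mod_cast h
  have hD' : (T (J.erase c) : ℝ) + D ≤ T J := by exact_mod_cast hD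
  have hb : 1 + (A : ℝ) * (-(1 / (J.card : ℝ))) ≤ (1 + -(1 / (J.card : ℝ))) ^ A := by
    apply one_add_mul_le_pow
    have : 1 / (J.card : ℝ) ≤ 1 := by rw [div_le_one] <;> linarith
    linarith
  have hfac : ((J.card : ℝ) - 1) ^ A = (J.card : ℝ) ^ A * (1 + -(1 / (J.card : ℝ))) ^ A := by
    rw [← mul_pow]
    congr 1
    field_simp
    ring
  rw [hfac] at h'
  have hpos : (0 : ℝ) < (J.card : ℝ) ^ A := by positivity
  have h3 : (T J : ℝ) * (1 + -(1 / (J.card : ℝ))) ^ A ≤ T (J.erase c) := by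
    nlinarith
  have h4 : (T J : ℝ) * (1 + (A : ℝ) * (-(1 / (J.card : ℝ)))) ≤ T (J.erase c) :=
    (mul_le_mul_of_nonneg_left hb (by positivity)).trans h3
  have h5 : (D : ℝ) ≤ A * T J / J.card := by
    have : (T J : ℝ) * (1 + (A : ℝ) * (-(1 / (J.card : ℝ)))) = T J - A * T J / J.card := by ring
    linarith
  rw [le_div_iff₀ (by linarith)] at h5
  exact_mod_cast h5

/-- A polynomial lower bound at a minimizer propagates to the whole family. -/
lemma le_of_minimizer {C J : Finset α} (hJC : J ⊆ C) (hJ : J.Nonempty)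
    (hmin : T J * C.card ^ A ≤ T C * J.card ^ A) {e κ N R : ℝ} (he : e ≤ A)
    (hN : 0 < N) (h : κ * (J.card / N) ^ e * R ≤ T J) :
    κ * (C.card / N) ^ e * R ≤ T C := by
  have hj : (0 : ℝ) < J.card := by exact_mod_cast hJ.card_pos
  have hle : (J.card : ℝ) ≤ C.card := by exact_mod_cast Finset.card_le_card hJC
  have hc : (0 : ℝ) < C.card := hj.trans_le hle
  have hmin' : (T J : ℝ) * (C.card : ℝ) ^ A ≤ T C * (J.card : ℝ) ^ A := by exact_mod_cast hmin
  have hone : 1 ≤ (C.card : ℝ) / J.card := by rwa [one_le_div hj]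
  have hratio : ((C.card : ℝ) / J.card) ^ e ≤ ((C.card : ℝ) / J.card) ^ A := by
    rw [← Real.rpow_natCast]
    exact Real.rpow_le_rpow_of_exponent_le hone he
  have hsplit : ((C.card : ℝ) / N) ^ e = (J.card / N) ^ e * (C.card / J.card) ^ e := by
    rw [← Real.mul_rpow (by positivity) (by positivity)]
    congr 1
    field_simp
  calc κ * (C.card / N) ^ e * R
      = κ * (J.card / N) ^ e * R * ((C.card : ℝ) / J.card) ^ e := by rw [hsplit]; ring
    _ ≤ T J * ((C.card : ℝ) / J.card) ^ e := mul_le_mul_of_nonneg_right h (by positivity)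
    _ ≤ T J * ((C.card : ℝ) / J.card) ^ A :=
        mul_le_mul_of_nonneg_left hratio (Nat.cast_nonneg _)
    _ ≤ T C := by
        rw [div_pow, ← mul_div_assoc, div_le_iff₀ (by positivity)]
        exact hmin'

end Minimizer

section Sampling

variable {p : ℕ} [Fact p.Prime] {V : Type} [AddCommGroup V] [Fintype V] [Module (ZMod p) V]

/-- Pairs `(x, y)` with `x ∈ A`, `y ∈ B` and `x + y ∈ S`. -/
noncomputable def schurPairs (A B S : Finset V) : Finset (V × V) :=
  Finset.univ.filter fun q => q.1 ∈ A ∧ q.2 ∈ B ∧ q.1 + q.2 ∈ S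

/-- The three directions along which two pairs can share a summand or the sum. -/
def sharingDirections : Finset (ℤ × ℤ) := {(0, 1), (1, 0), (1, -1)}

lemma card_linearCombination_fiber {d : ℕ} {w : Fin d → ZMod p} (hw : w ≠ 0) (t : V) :
    Fintype.card V * (Finset.univ.filter fun ψ : Fin d → V => ∑ i, w i • ψ i = t).card =
      Fintype.card V ^ d := by
  obtain ⟨i, hi⟩ := Function.ne_iff.mp hw
  let f : (Fin d → V) →+ V :=
    { toFun := fun ψ => ∑ i, w i • ψ i
      map_zero' := by simp
      map_add' := fun a b => by simp [Finset.sum_add_distrib] }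
  have hsurj : ∀ s, s ∈ Set.range f := fun s => by
    refine ⟨Pi.single i ((w i)⁻¹ • s), ?_⟩
    change ∑ j, w j • (Pi.single i ((w i)⁻¹ • s) : Fin d → V) j = s
    rw [Finset.sum_eq_single i]
    · simp [smul_smul, mul_inv_cancel₀ (show w i ≠ 0 from hi)]
    · intro j _ hj
      simp [hj]
    · simp
  have hfib : ∀ s, (Finset.univ.filter fun ψ => f ψ = s).card =
      (Finset.univ.filter fun ψ => f ψ = t).card := fun s =>
    AddMonoidHom.card_fiber_eq_of_mem_range f (hsurj s) (hsurj t)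
  have htot := Finset.card_eq_sum_card_fiberwise (f := f) (s := Finset.univ)
    (t := Finset.univ) (fun _ _ => by simp)
  simp only [hfib, Finset.sum_const, smul_eq_mul, Finset.card_univ, Fintype.card_fun,
    Fintype.card_fin] at htot
  exact htot.symm

lemma card_filter_add_right {G : Type*} [AddGroup G] [Fintype G] (P : G → Prop) [DecidablePred P]
    (c : G) :
    (Finset.univ.filter fun q => P (q + c)).card = (Finset.univ.filter P).card :=
  Finset.card_equiv (Equiv.addRight c) (by simp)

/-- Averaging over random affine copies of `F_p^d` in `V`. -/
lemma schurPairs_sampling (d : ℕ) (A B S : Finset V) (Δ : ℕ)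
    (hΔ : ∀ e ∈ sharingDirections, ∀ q ∈ schurPairs A B S,
      (Finset.univ.filter fun t : V => q + (e.1 • t, e.2 • t) ∈ schurPairs A B S).card ≤ Δ) :
    (p ^ d) ^ 2 * (schurPairs A B S).card * Fintype.card V ≤
      Fintype.card V ^ 3 * (3 * (lowDegree p d).card) +
        3 * (p ^ d) ^ 3 * (schurPairs A B S).card * Δ := by
  set Q := schurPairs A B S with hQ
  set N := Fintype.card V with hN
  let U := Fin d → ZMod p
  have hU : Fintype.card U = p ^ d := by simp [U, ZMod.card]
  let L : (Fin d → V) → U → V := fun ψ u => ∑ i, u i • ψ i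
  have hLadd : ∀ ψ u v, L ψ (u + v) = L ψ u + L ψ v := fun ψ u v => by
    simp only [L, ← Finset.sum_add_distrib, ← add_smul]
    rfl
  have hLzsmul : ∀ ψ (z : ℤ) u, L ψ (z • u) = z • L ψ u := fun ψ z u => by
    simp only [L, Finset.smul_sum]
    exact Finset.sum_congr rfl fun i _ => by rw [Pi.smul_apply, smul_assoc]
  let pt : (Fin d → V) → V × V → U × U → V × V := fun ψ a u => a + (L ψ u.1, L ψ u.2)
  let mv : U × U → ℤ × ℤ → U → U × U := fun u e w => u + (e.1 • w, e.2 • w)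
  have hmv : ∀ ψ a u e w, pt ψ a (mv u e w) =
      a + (L ψ u.1, L ψ u.2) + (e.1 • L ψ w, e.2 • L ψ w) := fun ψ a u e w => by
    simp only [pt, mv, Prod.fst_add, Prod.snd_add, hLadd, hLzsmul, add_assoc, Prod.mk_add_mk]
  let good : (Fin d → V) → V × V → Finset (U × U) := fun ψ a =>
    Finset.univ.filter fun u => pt ψ a u ∈ Q
  let bad : (Fin d → V) → V × V → ℤ × ℤ → U → Finset (U × U) := fun ψ a e w =>
    Finset.univ.filter fun u => pt ψ a u ∈ Q ∧ pt ψ a (mv u e w) ∈ Q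
  let W : Finset U := Finset.univ.filter fun w => w ≠ 0
  let iso : (Fin d → V) → V × V → Finset (U × U) := fun ψ a =>
    (good ψ a).filter fun u => ∀ e ∈ sharingDirections, ∀ w ∈ W, pt ψ a (mv u e w) ∉ Q
  have hiso : ∀ ψ a, (iso ψ a).card ≤ 3 * (lowDegree p d).card := by
    intro ψ a
    have := card_le_of_tricolored_sum_free (p := p) (d := d) (I := iso ψ a)
      (fun j => j.1.1) (fun j => j.1.2) (fun j => j.1.1 + j.1.2) ?_
    · simpa using this
    have hmem : ∀ j : iso ψ a, a.1 + L ψ j.1.1 ∈ A ∧ a.2 + L ψ j.1.2 ∈ B ∧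
        a.1 + L ψ j.1.1 + (a.2 + L ψ j.1.2) ∈ S := fun j => by
      have := (Finset.mem_filter.mp (Finset.mem_filter.mp j.2).1).2
      simpa [pt, hQ, schurPairs] using this
    have hsep : ∀ j : iso ψ a, ∀ e ∈ sharingDirections, ∀ w, pt ψ a (mv j.1 e w) ∈ Q → w = 0 := by
      intro j e he w hw
      by_contra hne
      exact (Finset.mem_filter.mp j.2).2 e he w (by simp [W, hne]) hw
    intro j k l
    constructor
    · intro h
      have hz : pt ψ a (j.1.1, k.1.2) ∈ Q := by
        have hs : a.1 + L ψ j.1.1 + (a.2 + L ψ k.1.2) =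
            a.1 + L ψ l.1.1 + (a.2 + L ψ l.1.2) := by
          have := congrArg (L ψ) h
          rw [hLadd, hLadd] at this
          rw [add_add_add_comm, this, add_add_add_comm]
        simp only [hQ, schurPairs, Finset.mem_filter, Finset.mem_univ, true_and, pt, Prod.fst_add,
          Prod.snd_add, hs]
        exact ⟨(hmem j).1, (hmem k).2.1, (hmem l).2.2⟩
      have e1 : k.1.2 - j.1.2 = 0 := hsep j (0, 1) (by decide) _ (by
        convert hz using 2
        ext1 <;> simp [mv])
      have e2 : j.1.1 - k.1.1 = 0 := hsep k (1, 0) (by decide) _ (by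
        convert hz using 2
        ext1 <;> simp [mv])
      have e3 : j.1.1 - l.1.1 = 0 := hsep l (1, -1) (by decide) _ (by
        convert hz using 2
        ext1
        · simp [mv]
        · simp only [mv, Prod.snd_add, neg_smul, one_smul]
          rw [eq_sub_of_add_eq' h]
          abel)
      rw [sub_eq_zero] at e1 e2 e3
      have hjk : j = k := Subtype.ext (Prod.ext e2 e1.symm)
      refine ⟨hjk, ?_⟩
      subst hjk
      refine Subtype.ext (Prod.ext e3 ?_)
      rw [e3] at h
      exact add_left_cancel h
    · rintro ⟨rfl, rfl⟩
      rfl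
  have hcover : ∀ ψ a, (good ψ a).card ≤ (iso ψ a).card +
      ∑ e ∈ sharingDirections, ∑ w ∈ W, (bad ψ a e w).card := by
    intro ψ a
    have hsub : good ψ a ⊆ iso ψ a ∪ sharingDirections.biUnion fun e => W.biUnion fun w =>
        bad ψ a e w := by
      intro u hu
      by_cases h : u ∈ iso ψ a
      · exact Finset.mem_union_left _ h
      · refine Finset.mem_union_right _ ?_
        have hu' : pt ψ a u ∈ Q := (Finset.mem_filter.mp hu).2
        have : ∃ e ∈ sharingDirections, ∃ w ∈ W, pt ψ a (mv u e w) ∈ Q := by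
          by_contra! hcon
          exact h (Finset.mem_filter.mpr ⟨hu, hcon⟩)
        obtain ⟨e, he, w, hw, hm⟩ := this
        exact Finset.mem_biUnion.mpr ⟨e, he, Finset.mem_biUnion.mpr ⟨w, hw, by
          simp [bad, hu', hm]⟩⟩
    refine (Finset.card_le_card hsub).trans ((Finset.card_union_le _ _).trans ?_)
    gcongr
    refine Finset.card_biUnion_le.trans (Finset.sum_le_sum fun e _ => Finset.card_biUnion_le)
  have hgood : ∑ ψ, ∑ a, (good ψ a).card = N ^ d * ((p ^ d) ^ 2 * Q.card) := by
    have h1 : ∀ ψ, ∑ a, (good ψ a).card = (p ^ d) ^ 2 * Q.card := fun ψ => by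
      simp only [good, Finset.card_filter]
      rw [Finset.sum_comm]
      have h2 : ∀ u, (∑ a, if pt ψ a u ∈ Q then 1 else 0) = Q.card := fun u => by
        rw [← Finset.card_filter]
        exact (card_filter_add_right (fun q => q ∈ Q) _).trans (by simp)
      simp [h2, hU, sq, U]
    simp [h1, hN]
  have hbad : ∀ e ∈ sharingDirections, ∀ w ∈ W,
      N * ∑ ψ, ∑ a, (bad ψ a e w).card ≤ N ^ d * ((p ^ d) ^ 2 * (Q.card * Δ)) := by
    intro e he w hw
    let R : V → ℕ := fun t => (Q.filter fun q => q + (e.1 • t, e.2 • t) ∈ Q).card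
    have h1 : ∀ ψ, ∑ a, (bad ψ a e w).card = (p ^ d) ^ 2 * R (L ψ w) := fun ψ => by
      simp only [bad, Finset.card_filter]
      rw [Finset.sum_comm]
      have h2 : ∀ u, (∑ a, if pt ψ a u ∈ Q ∧ pt ψ a (mv u e w) ∈ Q then 1 else 0) =
          R (L ψ w) := fun u => by
        rw [← Finset.card_filter]
        simp only [hmv]
        refine (card_filter_add_right
          (fun q => q ∈ Q ∧ q + (e.1 • L ψ w, e.2 • L ψ w) ∈ Q) _).trans ?_
        simp only [R]
        congr 1
        ext q
        simp
      simp [h2, hU, sq, U]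
    have h2 : N * ∑ ψ, R (L ψ w) = N ^ d * ∑ t, R t := by
      rw [← Finset.sum_fiberwise Finset.univ (fun ψ => L ψ w), Finset.mul_sum, Finset.mul_sum]
      refine Finset.sum_congr rfl fun t _ => ?_
      rw [← card_linearCombination_fiber (p := p) (w := w) (by simpa [W] using hw) t, mul_assoc]
      congr 1
      rw [Finset.sum_congr rfl (g := fun _ => R t), Finset.sum_const, smul_eq_mul]
      intro ψ hψ
      rw [(Finset.mem_filter.mp hψ).2]
    have h3 : ∑ t, R t ≤ Q.card * Δ := by
      simp only [R, Finset.card_filter]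
      rw [Finset.sum_comm]
      simp only [← Finset.card_filter]
      exact (Finset.sum_le_sum fun q hq => hΔ e he q hq).trans_eq (by simp)
    calc N * ∑ ψ, ∑ a, (bad ψ a e w).card = (p ^ d) ^ 2 * (N * ∑ ψ, R (L ψ w)) := by
          simp only [h1, ← Finset.mul_sum]; ring
      _ = N ^ d * ((p ^ d) ^ 2 * ∑ t, R t) := by rw [h2]; ring
      _ ≤ _ := by gcongr
  have hW : W.card ≤ p ^ d := (Finset.card_le_univ _).trans_eq hU
  have hsum : ∑ ψ, ∑ a, (good ψ a).card ≤ N ^ d * (N ^ 2 * (3 * (lowDegree p d).card)) +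
      ∑ e ∈ sharingDirections, ∑ w ∈ W, ∑ ψ, ∑ a, (bad ψ a e w).card := by
    calc ∑ ψ, ∑ a, (good ψ a).card
        ≤ ∑ ψ : Fin d → V, ∑ a : V × V, (3 * (lowDegree p d).card +
            ∑ e ∈ sharingDirections, ∑ w ∈ W, (bad ψ a e w).card) :=
          Finset.sum_le_sum fun ψ _ => Finset.sum_le_sum fun a _ =>
            (hcover ψ a).trans (Nat.add_le_add_right (hiso ψ a) _)
      _ = _ := by
          simp only [Finset.sum_add_distrib]
          congr 1
          · simp [hN, sq]
          · simp_rw [Finset.sum_comm (s := (Finset.univ : Finset (V × V)))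
              (t := sharingDirections), Finset.sum_comm (s := (Finset.univ : Finset (V × V)))
              (t := W)]
            rw [Finset.sum_comm]
            exact Finset.sum_congr rfl fun e _ => Finset.sum_comm
  have hbadtot : N * ∑ e ∈ sharingDirections, ∑ w ∈ W, ∑ ψ, ∑ a, (bad ψ a e w).card ≤
      N ^ d * (3 * (p ^ d) ^ 3 * Q.card * Δ) := by
    rw [Finset.mul_sum]
    calc _ ≤ ∑ e ∈ sharingDirections, ∑ w ∈ W, N ^ d * ((p ^ d) ^ 2 * (Q.card * Δ)) := by
          refine Finset.sum_le_sum fun e he => ?_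
          rw [Finset.mul_sum]
          exact Finset.sum_le_sum fun w hw => hbad e he w hw
      _ = W.card * (3 * (N ^ d * ((p ^ d) ^ 2 * (Q.card * Δ)))) := by
          simp only [Finset.sum_const, smul_eq_mul]
          rw [show sharingDirections.card = 3 from rfl]
          ring
      _ ≤ p ^ d * (3 * (N ^ d * ((p ^ d) ^ 2 * (Q.card * Δ)))) := Nat.mul_le_mul_right _ hW
      _ = _ := by ring
  have hNd : 0 < N ^ d := pow_pos Fintype.card_pos _
  refine Nat.le_of_mul_le_mul_left ?_ hNd
  have := Nat.mul_le_mul_left N (hgood ▸ hsum)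
  nlinarith

end Sampling

section SchurPairs

variable {V : Type} [AddCommGroup V] [Fintype V]

/-- The pairs `(x, y)` whose entries and sum are entries and sums of members of `C`. -/
noncomputable def schurSpan (C : Finset (V × V)) : Finset (V × V) :=
  schurPairs (C.image Prod.fst) (C.image Prod.snd) (C.image fun q => q.1 + q.2)

lemma mem_schurSpan {C : Finset (V × V)} {q : V × V} :
    q ∈ schurSpan C ↔ q.1 ∈ C.image Prod.fst ∧ q.2 ∈ C.image Prod.snd ∧
      q.1 + q.2 ∈ C.image fun q => q.1 + q.2 := by
  simp only [schurSpan, schurPairs, Finset.mem_filter, Finset.mem_univ, true_and]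

lemma schurSpan_mono {C C' : Finset (V × V)} (h : C ⊆ C') : schurSpan C ⊆ schurSpan C' := by
  intro q hq
  rw [mem_schurSpan] at hq ⊢
  exact ⟨Finset.image_subset_image h hq.1, Finset.image_subset_image h hq.2.1,
    Finset.image_subset_image h hq.2.2⟩

lemma subset_schurSpan (C : Finset (V × V)) : C ⊆ schurSpan C := fun _ hq =>
  mem_schurSpan.mpr ⟨Finset.mem_image_of_mem _ hq, Finset.mem_image_of_mem _ hq,
    Finset.mem_image_of_mem (fun q : V × V => q.1 + q.2) hq⟩

/-- At a minimizer, few pairs share the value of an injective statistic. -/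
lemma schurSpan_degree_le {A : ℕ} (hA : 1 ≤ A) {J : Finset (V × V)}
    (hmin : ∀ J' ⊆ J, J'.Nonempty →
      (schurSpan J).card * J'.card ^ A ≤ (schurSpan J').card * J.card ^ A)
    {φ : V × V → V} (hφ : ∀ (C : Finset (V × V)), ∀ q ∈ schurSpan C, φ q ∈ C.image φ)
    (hinj : Set.InjOn φ J) {q : V × V} (hq : q ∈ schurSpan J) :
    ((schurSpan J).filter fun q' => φ q' = φ q).card * J.card ≤ A * (schurSpan J).card := by
  obtain ⟨c, hc, hcq⟩ := Finset.mem_image.mp (hφ J q hq)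
  refine degree_le_of_minimizer (T := fun J => (schurSpan J).card) hA hmin hc ?_
  rw [← Finset.card_union_of_disjoint]
  · exact Finset.card_le_card (Finset.union_subset (schurSpan_mono (Finset.erase_subset _ _))
      (Finset.filter_subset _ _))
  · refine Finset.disjoint_left.mpr fun q' h1 h2 => ?_
    obtain ⟨c', hc', h'⟩ := Finset.mem_image.mp (hφ _ q' h1)
    obtain ⟨hne, hc'J⟩ := Finset.mem_erase.mp hc'
    exact hne (hinj hc'J hc (by rw [h', (Finset.mem_filter.mp h2).2, hcq]))

lemma card_translates_le {J : Finset (V × V)} {φ : V × V → V} {f : V → V × V}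
    (hf : Function.Injective f) {q : V × V} (hφ : ∀ t, φ (q + f t) = φ q) :
    (Finset.univ.filter fun t : V => q + f t ∈ schurSpan J).card ≤
      ((schurSpan J).filter fun q' => φ q' = φ q).card := by
  refine Finset.card_le_card_of_injOn (fun t => q + f t) (fun t ht => ?_) fun t _ t' _ h =>
    hf (add_left_cancel h)
  simpa [hφ t] using ht

lemma le_of_sampling_bound {p A d : ℕ} (hp : 2 ≤ p) (hA : 1 ≤ A) {c N m T : ℝ} (hc : 0 < c)
    (hN : 0 < N) (hm : 0 < m) (hT : 0 < T) (hd1 : (p : ℝ) ^ d ≤ N * m / (6 * A * T))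
    (hd2 : N * m / (6 * A * T) < (p : ℝ) ^ (d + 1))
    (h : ((p : ℝ) ^ d) ^ 2 * T * N ≤ N ^ 3 * (3 * ((p : ℝ) ^ d) ^ (1 - c)) +
      3 * ((p : ℝ) ^ d) ^ 3 * T * (A * T / m)) :
    (36 * p * A : ℝ) ^ (-(1 / c)) / (6 * p * A) * (m / N) ^ (1 + 1 / c) * N ^ 2 ≤ T := by
  have hp' : (0 : ℝ) < p := by positivity
  have hA' : (0 : ℝ) < A := by exact_mod_cast hA
  set D : ℝ := (p : ℝ) ^ d with hD
  have hDpos : 0 < D := by positivity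
  rw [le_div_iff₀ (by positivity)] at hd1
  have hd2' : N * m < 6 * p * A * T * D := by
    rw [div_lt_iff₀ (by positivity), pow_succ] at hd2
    nlinarith
  have h1 : 3 * D ^ 3 * T * (A * T / m) ≤ D ^ 2 * T * N / 2 := by
    rw [mul_div_assoc', div_le_iff₀ hm]
    have : 0 < D ^ 2 * T := by positivity
    nlinarith
  have h2 : D ^ 2 * T ≤ 6 * N ^ 2 * D ^ (1 - c) := by
    refine le_of_mul_le_mul_right (a := N) ?_ hN
    nlinarith
  have h3 : D * D ^ c * T ≤ 6 * N ^ 2 := by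
    refine le_of_mul_le_mul_right (a := D ^ (1 - c)) ?_ (by positivity)
    have : D ^ c * D ^ (1 - c) = D := by
      rw [← Real.rpow_add hDpos]
      simp
    calc D * D ^ c * T * D ^ (1 - c) = D * (D ^ c * D ^ (1 - c)) * T := by ring
      _ ≤ _ := by rw [this, ← sq]; exact h2
  have h4 : D ^ c ≤ 36 * p * A * (N / m) := by
    rw [mul_div_assoc', le_div_iff₀ hm]
    refine le_of_mul_le_mul_right (a := N) ?_ hN
    calc D ^ c * m * N = D ^ c * (N * m) := by ring
      _ ≤ D ^ c * (6 * p * A * T * D) := by gcongr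
      _ = 6 * p * A * (D * D ^ c * T) := by ring
      _ ≤ 6 * p * A * (6 * N ^ 2) := by gcongr
      _ = 36 * p * A * N * N := by ring
  have h5 : D ≤ (36 * p * A * (N / m)) ^ (1 / c) := by
    rw [one_div]
    exact (Real.le_rpow_inv_iff_of_pos hDpos.le (by positivity) hc).mpr h4
  have h6 : (36 * p * A * (N / m)) ^ (1 / c) * ((36 * p * A : ℝ) ^ (-(1 / c)) * (m / N) ^ (1 / c)) =
      1 := by
    rw [Real.mul_rpow (by positivity) (by positivity), Real.rpow_neg (by positivity),
      ← inv_div N m, Real.inv_rpow (by positivity)]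
    have a1 : (36 * p * A : ℝ) ^ (1 / c) ≠ 0 := by positivity
    have a2 : (N / m) ^ (1 / c) ≠ 0 := by positivity
    field_simp
  set w := (36 * p * A : ℝ) ^ (-(1 / c)) * (m / N) ^ (1 / c) with hw
  have hwpos : 0 < w := by positivity
  have h7 : D * w ≤ 1 := (mul_le_mul_of_nonneg_right h5 hwpos.le).trans_eq h6
  have h8 : (36 * p * A : ℝ) ^ (-(1 / c)) / (6 * p * A) * (m / N) ^ (1 + 1 / c) * N ^ 2 =
      w * (N * m) / (6 * p * A) := by
    rw [Real.rpow_add (by positivity), Real.rpow_one, hw]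
    field_simp
  rw [h8, div_le_iff₀ (by positivity)]
  calc w * (N * m) ≤ w * (6 * p * A * T * D) := by gcongr
    _ = (D * w) * (T * (6 * p * A)) := by ring
    _ ≤ 1 * (T * (6 * p * A)) := by gcongr
    _ = _ := one_mul _

/-- A tight bound for the triangle removal problem, up to a constant factor. -/
theorem exists_schurSpan_lower_bound (p : ℕ) [Fact p.Prime] :
    ∃ κ : ℝ, 0 < κ ∧ ∀ (V : Type) [AddCommGroup V] [Fintype V] [Module (ZMod p) V]
      (C : Finset (V × V)), Set.InjOn Prod.fst (C : Set (V × V)) →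
      Set.InjOn Prod.snd (C : Set (V × V)) →
      Set.InjOn (fun q => q.1 + q.2) (C : Set (V × V)) →
      κ * (C.card / (Fintype.card V : ℝ)) ^ (1 + 1 / cp3 p) * (Fintype.card V : ℝ) ^ 2 ≤
        (schurSpan C).card := by
  have hp := (Fact.out : p.Prime).two_le
  have hp1 : (1 : ℝ) < p := by exact_mod_cast hp
  have hc := cp3_pos hp
  set c := cp3 p with hcdef
  obtain ⟨A, hA⟩ := exists_nat_ge (1 + 1 / c)
  have hA1 : 1 ≤ A := by
    have : (0 : ℝ) < 1 / c := by positivity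
    have : (1 : ℝ) < A := by linarith
    exact_mod_cast this.le
  have hA1' : (1 : ℝ) ≤ A := by exact_mod_cast hA1
  refine ⟨(36 * p * A : ℝ) ^ (-(1 / c)) / (6 * p * A), by positivity, ?_⟩
  intro V _ _ _ C hfst hsnd hsum
  have hN : (0 : ℝ) < Fintype.card V := by exact_mod_cast Fintype.card_pos
  rcases C.eq_empty_or_nonempty with rfl | hC
  · rw [Finset.card_empty, Nat.cast_zero, zero_div, Real.zero_rpow (by positivity)]
    simp
  obtain ⟨J, hJC, hJ, hmin⟩ := exists_minimizer hC (fun C => (schurSpan C).card) A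
  refine le_of_minimizer (T := fun C => (schurSpan C).card) hJC hJ
    (hmin C (Finset.Subset.refl _) hC) hA hN ?_
  have hmin' := fun J' (h : J' ⊆ J) => hmin J' (h.trans hJC)
  have hm : 0 < J.card := hJ.card_pos
  have hmR : (0 : ℝ) < J.card := by exact_mod_cast hm
  have hT : 0 < (schurSpan J).card := (hJ.mono (subset_schurSpan J)).card_pos
  have hTR : (0 : ℝ) < (schurSpan J).card := by exact_mod_cast hT
  have hmN : (J.card : ℝ) ≤ Fintype.card V := by
    have h := Finset.card_le_univ (J.image Prod.fst)
    rw [Finset.card_image_of_injOn (hfst.mono (Finset.coe_subset.mpr hJC))] at h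
    exact_mod_cast h
  rcases le_or_gt 1 ((Fintype.card V : ℝ) * J.card / (6 * A * (schurSpan J).card)) with hbig | hsmall
  · obtain ⟨d, hd1, hd2⟩ := exists_nat_pow_near hbig hp1
    refine le_of_sampling_bound hp hA1 hc hN hmR hTR hd1 hd2 ?_
    have hdeg : ∀ e ∈ sharingDirections, ∀ q ∈ schurSpan J,
        (Finset.univ.filter fun t : V => q + (e.1 • t, e.2 • t) ∈ schurSpan J).card ≤
          A * (schurSpan J).card / J.card := by
      intro e he q hq
      rw [Nat.le_div_iff_mul_le hm]
      simp only [sharingDirections, Finset.mem_insert, Finset.mem_singleton] at he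
      rcases he with rfl | rfl | rfl
      · refine (Nat.mul_le_mul_right _ (card_translates_le (φ := Prod.fst)
          (f := fun t => ((0 : ℤ) • t, (1 : ℤ) • t)) (fun t t' h => ?_) (fun t => ?_))).trans
          (schurSpan_degree_le hA1 hmin' (fun C q hq => (mem_schurSpan.mp hq).1)
            (hfst.mono (Finset.coe_subset.mpr hJC)) hq)
        · simpa using h
        · simp
      · refine (Nat.mul_le_mul_right _ (card_translates_le (φ := Prod.snd)
          (f := fun t => ((1 : ℤ) • t, (0 : ℤ) • t)) (fun t t' h => ?_) (fun t => ?_))).trans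
          (schurSpan_degree_le hA1 hmin' (fun C q hq => (mem_schurSpan.mp hq).2.1)
            (hsnd.mono (Finset.coe_subset.mpr hJC)) hq)
        · simpa using h
        · simp
      · refine (Nat.mul_le_mul_right _ (card_translates_le (φ := fun q => q.1 + q.2)
          (f := fun t => ((1 : ℤ) • t, (-1 : ℤ) • t)) (fun t t' h => ?_) (fun t => ?_))).trans
          (schurSpan_degree_le hA1 hmin' (fun C q hq => (mem_schurSpan.mp hq).2.2)
            (hsum.mono (Finset.coe_subset.mpr hJC)) hq)
        · simpa using h
        · simp only [Prod.fst_add, Prod.snd_add, one_smul, neg_smul]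
          abel
    have hs := schurPairs_sampling (p := p) d _ _ _ _ hdeg
    rw [← schurSpan] at hs
    have hs' : ((p : ℝ) ^ d) ^ 2 * (schurSpan J).card * Fintype.card V ≤
        (Fintype.card V : ℝ) ^ 3 * (3 * (lowDegree p d).card) + 3 * ((p : ℝ) ^ d) ^ 3 *
          (schurSpan J).card * ((A * (schurSpan J).card / J.card : ℕ) : ℝ) := by
      exact_mod_cast hs
    refine hs'.trans ?_
    have h1 := card_lowDegree_le_rpow hp d
    have h2 : ((A * (schurSpan J).card / J.card : ℕ) : ℝ) ≤
        A * (schurSpan J).card / J.card := by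
      refine Nat.cast_div_le.trans_eq ?_
      push_cast
      rfl
    gcongr
  · rw [div_lt_one (by positivity)] at hsmall
    rw [Real.rpow_add (by positivity), Real.rpow_one]
    have h1 : ((J.card : ℝ) / Fintype.card V) ^ (1 / c) ≤ 1 :=
      Real.rpow_le_one (by positivity) (by rwa [div_le_one hN]) (by positivity)
    have h2 : (36 * p * A : ℝ) ^ (-(1 / c)) ≤ 1 :=
      Real.rpow_le_one_of_one_le_of_nonpos (by nlinarith) (by
        have : (0 : ℝ) < 1 / c := by positivity
        linarith)
    calc (36 * p * A : ℝ) ^ (-(1 / c)) / (6 * p * A) *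
          (J.card / (Fintype.card V : ℝ) * (J.card / (Fintype.card V : ℝ)) ^ (1 / c)) *
          (Fintype.card V : ℝ) ^ 2
        ≤ 1 / (6 * 1 * A) * (J.card / (Fintype.card V : ℝ) * 1) * (Fintype.card V : ℝ) ^ 2 := by
          gcongr
      _ = (Fintype.card V : ℝ) * J.card / (6 * A) := by field_simp
      _ ≤ (schurSpan J).card := by
          rw [div_le_iff₀ (by positivity)]
          linarith

end SchurPairs

lemma sum_inv_card_fiber {α β : Type*} (Y : Finset α) (s : α → β) :
    ∑ y ∈ Y, (1 : ℝ) / (Y.filter fun z => s z = s y).card = (Y.image s).card := by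
  rw [← Finset.sum_fiberwise_of_maps_to (t := Y.image s)
    fun y hy => Finset.mem_image_of_mem s hy, Finset.card_eq_sum_ones, Nat.cast_sum]
  refine Finset.sum_congr rfl fun v hv => ?_
  obtain ⟨y, hy, rfl⟩ := Finset.mem_image.mp hv
  have hpos : (0 : ℝ) < (Y.filter fun z => s z = s y).card := by
    exact_mod_cast Finset.card_pos.mpr ⟨y, by simp [hy]⟩
  rw [Finset.sum_congr rfl (g := fun _ => (1 : ℝ) / (Y.filter fun z => s z = s y).card)]
  · rw [Finset.sum_const, nsmul_eq_mul]
    field_simp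
    simp
  · intro z hz
    rw [(Finset.mem_filter.mp hz).2]

lemma four_le_of_mul_le {p₁ p₂ q₁ q₂ n n' Δ : ℝ} (hp₁ : 0 < p₁) (hp₂ : 0 < p₂) (hq₁ : 0 < q₁)
    (hq₂ : 0 < q₂) (hn : 0 < n) (hn' : 0 < n') (hΔ : 0 < Δ) (h : n ≤ p₁ * p₂)
    (h' : n' ≤ q₁ * q₂) :
    4 ≤ (p₁ * q₂ + p₂ * q₁) / Δ + Δ * (1 / n + 1 / n') := by
  obtain ⟨x, hx, hxx⟩ : ∃ x > 0, x ^ 2 = p₁ * p₂ :=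
    ⟨√(p₁ * p₂), by positivity, Real.sq_sqrt (by positivity)⟩
  obtain ⟨y, hy, hyy⟩ : ∃ y > 0, y ^ 2 = q₁ * q₂ :=
    ⟨√(q₁ * q₂), by positivity, Real.sq_sqrt (by positivity)⟩
  have h1 : 2 * (x * y) ≤ p₁ * q₂ + p₂ * q₁ := by
    refine le_of_sq_le_sq ?_ (by positivity)
    nlinarith [sq_nonneg (p₁ * q₂ - p₂ * q₁), mul_pow x y 2]
  have h2 : 1 / x ^ 2 + 1 / y ^ 2 ≤ 1 / n + 1 / n' := by
    rw [hxx, hyy]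
    gcongr
  have h3 : 2 / (x * y) ≤ 1 / x ^ 2 + 1 / y ^ 2 := by
    have : 1 / x ^ 2 + 1 / y ^ 2 - 2 / (x * y) = (1 / x - 1 / y) ^ 2 := by
      field_simp
      ring
    nlinarith [sq_nonneg (1 / x - 1 / y)]
  have h4 : 4 ≤ 2 * (x * y) / Δ + Δ * (2 / (x * y)) := by
    have : 2 * (x * y) / Δ + Δ * (2 / (x * y)) - 4 = 2 * (x * y - Δ) ^ 2 / (Δ * (x * y)) := by
      field_simp
      ring
    have : 0 ≤ 2 * (x * y - Δ) ^ 2 / (Δ * (x * y)) := by positivity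
    linarith
  calc 4 ≤ 2 * (x * y) / Δ + Δ * (2 / (x * y)) := h4
    _ ≤ _ := by
      have := h3.trans h2
      gcongr

section Cycles

variable {ι V : Type} [AddCommGroup V]

/-- Replace the coordinates `a` and `b` by their sum, stored in coordinate `a`. -/
noncomputable def mergeCoords (a b : ι) (y : ι → V) : {i // i ≠ b} → V :=
  fun i => y i + if (i : ι) = a then y b else 0

lemma mergeCoords_self {a b : ι} (hab : a ≠ b) (y : ι → V) :
    mergeCoords a b y ⟨a, hab⟩ = y a + y b := by
  simp [mergeCoords]

lemma mergeCoords_of_ne {a b : ι} (y : ι → V) {i : {i // i ≠ b}} (hi : (i : ι) ≠ a) :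
    mergeCoords a b y i = y i := by
  simp [mergeCoords, hi]

variable [Fintype ι]

/-- A family of zero-sum tuples which are disjoint in every coordinate. -/
structure IsMatching (C : Finset (ι → V)) : Prop where
  sum_eq_zero : ∀ c ∈ C, ∑ i, c i = 0
  injOn : ∀ i, Set.InjOn (fun c => c i) (C : Set (ι → V))

lemma IsMatching.mono {C C' : Finset (ι → V)} (h : IsMatching C) (hC : C' ⊆ C) : IsMatching C' :=
  ⟨fun c hc => h.sum_eq_zero c (hC hc), fun i => (h.injOn i).mono (Finset.coe_subset.mpr hC)⟩

lemma exists_maximal_matching {β : Type*} {Y : Finset (ι → V)} (h0 : ∀ y ∈ Y, ∑ i, y i = 0)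
    (f : (ι → V) → β) [Nonempty ι] :
    ∃ C ⊆ Y, IsMatching C ∧ Set.InjOn f (C : Set (ι → V)) ∧
      ∀ y ∈ Y, (∀ i, ∀ d ∈ C, d i ≠ y i) → ∃ d ∈ C, f d = f y := by
  obtain ⟨C, hC, hmax⟩ := Finset.exists_max_image
    (Y.powerset.filter fun C => IsMatching C ∧ Set.InjOn f (C : Set (ι → V))) Finset.card
    ⟨∅, by simpa using ⟨by simp, by simp⟩⟩
  simp only [Finset.mem_filter, Finset.mem_powerset] at hC hmax
  obtain ⟨hCY, hM, hf⟩ := hC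
  refine ⟨C, hCY, hM, hf, fun y hy hne => ?_⟩
  by_contra hfy
  have hyC : y ∉ C := fun h => by
    obtain ⟨i⟩ := ‹Nonempty ι›
    exact hne i y h rfl
  have := hmax (insert y C) ⟨Finset.insert_subset hy hCY, ⟨fun c hc => ?_, fun i => ?_⟩, ?_⟩
  · rw [Finset.card_insert_of_notMem hyC] at this
    omega
  · exact h0 c (Finset.insert_subset hy hCY hc)
  · rw [Finset.coe_insert, Set.injOn_insert (by simpa using hyC)]
    refine ⟨hM.injOn i, ?_⟩
    rintro ⟨d, hd, h⟩
    exact hne i d hd h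
  · rw [Finset.coe_insert, Set.injOn_insert (by simpa using hyC)]
    exact ⟨hf, by simpa using hfy⟩

/-- The members of `J` meeting a given family in some coordinate are few. -/
lemma IsMatching.card_filter_meets_le {J : Finset (ι → V)} (hJ : IsMatching J)
    (D : Finset (ι → V)) :
    (J.filter fun c => ∃ i, ∃ d ∈ D, d i = c i).card ≤ Fintype.card ι * D.card := by
  have hsub : (J.filter fun c => ∃ i, ∃ d ∈ D, d i = c i) ⊆
      (Finset.univ ×ˢ D).biUnion fun x => J.filter fun c => x.2 x.1 = c x.1 := by
    intro c hc
    obtain ⟨hcJ, i, d, hd, h⟩ := Finset.mem_filter.mp hc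
    exact Finset.mem_biUnion.mpr ⟨(i, d), by simp [hd], by simp [hcJ, h]⟩
  refine (Finset.card_le_card hsub).trans ((Finset.card_biUnion_le_card_mul _ _ 1 ?_).trans ?_)
  · intro x _
    refine Finset.card_le_one.mpr fun c hc c' hc' => ?_
    simp only [Finset.mem_filter] at hc hc'
    exact hJ.injOn x.1 hc.1 hc'.1 (hc.2.symm.trans hc'.2)
  · simp

lemma sum_card_agree_mul_card_agree_le {Y : Finset (ι → V)} (h0 : ∀ y ∈ Y, ∑ i, y i = 0)
    {P R : Finset ι} {b j : ι} (hbP : b ∈ P) (hbR : b ∈ R) (hcov : ∀ i, i ≠ j → i ∈ P ∨ i ∈ R)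
    {Δ : ℕ} (hΔ : ∀ y ∈ Y, (Y.filter fun z => z b = y b).card ≤ Δ) :
    ∑ y ∈ Y, (Y.filter fun z => ∀ i ∈ P, z i = y i).card *
      (Y.filter fun z => ∀ i ∈ R, z i = y i).card ≤ Y.card * Δ := by
  have h1 : ∑ y ∈ Y, (Y.filter fun z => z b = y b).card ≤ Y.card * Δ := by
    simpa using Finset.sum_le_card_nsmul Y _ Δ hΔ
  refine le_trans ?_ h1
  simp only [← Finset.card_product]
  rw [← Finset.card_sigma, ← Finset.card_sigma]
  refine Finset.card_le_card_of_injOn (fun x => ⟨x.2.1, x.2.2⟩) ?_ ?_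
  · rintro ⟨y, z, z'⟩ hx
    simp only [Finset.coe_sigma, Set.mem_sigma_iff, Finset.mem_coe, Finset.mem_product,
      Finset.mem_filter] at hx ⊢
    exact ⟨hx.2.1.1, hx.2.2.1, (hx.2.2.2 b hbR).trans (hx.2.1.2 b hbP).symm⟩
  · rintro ⟨y, z, z'⟩ hx ⟨w, v, v'⟩ hx' h
    simp only [Finset.coe_sigma, Set.mem_sigma_iff, Finset.mem_coe, Finset.mem_product,
      Finset.mem_filter] at hx hx'
    simp only [Sigma.mk.injEq, heq_eq_eq] at h
    obtain ⟨rfl, rfl⟩ := h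
    have hne : ∀ i, i ≠ j → y i = w i := fun i hi => by
      rcases hcov i hi with hP | hR
      · rw [← hx.2.1.2 i hP, ← hx'.2.1.2 i hP]
      · rw [← hx.2.2.2 i hR, ← hx'.2.2.2 i hR]
    have hj : y j = w j := by
      have e1 := h0 y hx.1
      have e2 := h0 w hx'.1
      rw [← Finset.add_sum_erase _ _ (Finset.mem_univ j)] at e1 e2
      rw [Finset.sum_congr rfl fun i hi => hne i (Finset.ne_of_mem_erase hi)] at e1
      exact add_right_cancel (e1.trans e2.symm)
    have : y = w := by
      funext i
      by_cases hi : i = j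
      · rw [hi, hj]
      · exact hne i hi
    rw [this]

lemma sum_mergeCoords {a b : ι} (hab : a ≠ b) (y : ι → V) :
    ∑ i, mergeCoords a b y i = ∑ i, y i := by
  have h := Fintype.sum_eq_add_sum_subtype_ne (fun i => y i + if i = a then y b else 0) b
  rw [Finset.sum_add_distrib, Finset.sum_ite_eq' Finset.univ a, if_pos (Finset.mem_univ a),
    if_neg hab.symm, add_zero, add_comm] at h
  exact (add_left_cancel h).symm

lemma IsMatching.image_mergeCoords {C : Finset (ι → V)} (hC : IsMatching C) {a b : ι}
    (hab : a ≠ b) (hinj : Set.InjOn (fun y => y a + y b) (C : Set (ι → V))) :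
    IsMatching (C.image (mergeCoords a b)) ∧ (C.image (mergeCoords a b)).card = C.card := by
  refine ⟨⟨?_, fun i => ?_⟩, Finset.card_image_of_injOn fun y hy z hz h => ?_⟩
  · intro z hz
    obtain ⟨y, hy, rfl⟩ := Finset.mem_image.mp hz
    rw [sum_mergeCoords hab, hC.sum_eq_zero y hy]
  · intro z hz z' hz' h
    obtain ⟨y, hy, rfl⟩ := Finset.mem_image.mp hz
    obtain ⟨y', hy', rfl⟩ := Finset.mem_image.mp hz'
    change mergeCoords a b y i = mergeCoords a b y' i at h
    congr 1
    obtain ⟨i, hi⟩ := i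
    by_cases hia : i = a
    · subst hia
      rw [mergeCoords_self, mergeCoords_self] at h
      exact hinj hy hy' h
    · rw [mergeCoords_of_ne _ hia, mergeCoords_of_ne _ hia] at h
      exact hC.injOn i hy hy' h
  · refine hinj hy hz ?_
    have := congrFun h ⟨a, hab⟩
    rwa [mergeCoords_self, mergeCoords_self] at this

variable [Fintype V]

/-- The tuples with zero sum all of whose entries are entries of members of `C`. -/
noncomputable def cyclesOf (C : Finset (ι → V)) : Finset (ι → V) :=
  Finset.univ.filter fun y => (∀ i, ∃ c ∈ C, c i = y i) ∧ ∑ i, y i = 0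

lemma mem_cyclesOf {C : Finset (ι → V)} {y : ι → V} :
    y ∈ cyclesOf C ↔ (∀ i, ∃ c ∈ C, c i = y i) ∧ ∑ i, y i = 0 := by
  simp only [cyclesOf, Finset.mem_filter, Finset.mem_univ, true_and]

lemma cyclesOf_mono {C C' : Finset (ι → V)} (h : C ⊆ C') : cyclesOf C ⊆ cyclesOf C' := by
  intro y hy
  rw [mem_cyclesOf] at hy ⊢
  exact ⟨fun i => (hy.1 i).imp fun c hc => ⟨h hc.1, hc.2⟩, hy.2⟩

lemma cyclesOf_subset_cyclesOf {C C' : Finset (ι → V)} (h : C' ⊆ cyclesOf C) :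
    cyclesOf C' ⊆ cyclesOf C := by
  intro y hy
  rw [mem_cyclesOf] at hy ⊢
  refine ⟨fun i => ?_, hy.2⟩
  obtain ⟨c, hc, hci⟩ := hy.1 i
  obtain ⟨c', hc', h'⟩ := (mem_cyclesOf.mp (h hc)).1 i
  exact ⟨c', hc', h'.trans hci⟩

lemma IsMatching.subset_cyclesOf {C : Finset (ι → V)} (h : IsMatching C) : C ⊆ cyclesOf C := fun c hc =>
  mem_cyclesOf.mpr ⟨fun _ => ⟨c, hc, rfl⟩, h.sum_eq_zero c hc⟩

/-- At a minimizer, few cycles share a coordinate. -/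
lemma IsMatching.degree_le {A : ℕ} (hA : 1 ≤ A) {J : Finset (ι → V)} (hJ : IsMatching J)
    (hmin : ∀ J' ⊆ J, J'.Nonempty →
      (cyclesOf J).card * J'.card ^ A ≤ (cyclesOf J').card * J.card ^ A)
    (i : ι) {y : ι → V} (hy : y ∈ cyclesOf J) :
    ((cyclesOf J).filter fun z => z i = y i).card * J.card ≤ A * (cyclesOf J).card := by
  obtain ⟨c, hc, hcy⟩ := (mem_cyclesOf.mp hy).1 i
  refine degree_le_of_minimizer (T := fun J => (cyclesOf J).card) hA hmin hc ?_
  rw [← Finset.card_union_of_disjoint]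
  · exact Finset.card_le_card (Finset.union_subset (cyclesOf_mono (Finset.erase_subset _ _))
      (Finset.filter_subset _ _))
  · refine Finset.disjoint_left.mpr fun z h1 h2 => ?_
    obtain ⟨c', hc', h'⟩ := (mem_cyclesOf.mp h1).1 i
    obtain ⟨hne, hc'J⟩ := Finset.mem_erase.mp hc'
    exact hne (hJ.injOn i hc'J hc (by
      change c' i = c i
      rw [h', (Finset.mem_filter.mp h2).2, hcy]))

/-- Cycles can be recombined along a set of coordinates with equal partial sums. -/
lemma piecewise_mem_cyclesOf {J : Finset (ι → V)} {y z : ι → V} (hy : y ∈ cyclesOf J)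
    (hz : z ∈ cyclesOf J) {P : Finset ι} (h : ∑ i ∈ P, y i = ∑ i ∈ P, z i) :
    P.piecewise y z ∈ cyclesOf J := by
  rw [mem_cyclesOf] at hy hz ⊢
  refine ⟨fun i => ?_, ?_⟩
  · by_cases hi : i ∈ P
    · simpa [hi] using hy.1 i
    · simpa [hi] using hz.1 i
  · rw [Finset.sum_piecewise, Finset.univ_inter, h, ← Finset.compl_eq_univ_sdiff,
      Finset.sum_add_sum_compl, hz.2]

lemma card_fiber_le_card_agree_mul_card_agree {J : Finset (ι → V)} {y : ι → V}
    (hy : y ∈ cyclesOf J) (P : Finset ι) :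
    ((cyclesOf J).filter fun z => ∑ i ∈ P, z i = ∑ i ∈ P, y i).card ≤
      ((cyclesOf J).filter fun z => ∀ i ∈ P, z i = y i).card *
        ((cyclesOf J).filter fun z => ∀ i ∈ Pᶜ, z i = y i).card := by
  rw [← Finset.card_product]
  refine Finset.card_le_card_of_injOn (fun z => (P.piecewise y z, P.piecewise z y)) ?_ ?_
  · intro z hz
    simp only [Finset.coe_filter, Set.mem_ofPred_eq] at hz
    simp only [Finset.mem_coe, Finset.mem_product, Finset.mem_filter]
    refine ⟨⟨piecewise_mem_cyclesOf hy hz.1 hz.2.symm, fun i hi => by simp [hi]⟩,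
      piecewise_mem_cyclesOf hz.1 hy hz.2, fun i hi => ?_⟩
    simp [Finset.mem_compl.mp hi]
  · intro z _ z' _ h
    simp only [Prod.mk.injEq] at h
    funext i
    by_cases hi : i ∈ P
    · simpa [hi] using congrFun h.2 i
    · simpa [hi] using congrFun h.1 i

/-- If few cycles share the coordinate `b` or `c`, then the cycles have many partial sums over
one of the pairs `{a, b}` and `{a, c}`. -/
lemma two_mul_card_cyclesOf_le {J : Finset (ι → V)} {a b c : ι} (hab : a ≠ b) (hac : a ≠ c)
    (hbc : b ≠ c) {Δ : ℕ} (hb : ∀ y ∈ cyclesOf J, ((cyclesOf J).filter fun z => z b = y b).card ≤ Δ)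
    (hc : ∀ y ∈ cyclesOf J, ((cyclesOf J).filter fun z => z c = y c).card ≤ Δ) :
    2 * (cyclesOf J).card ≤ Δ * (((cyclesOf J).image fun y => y a + y b).card +
      ((cyclesOf J).image fun y => y a + y c).card) := by
  set Y := cyclesOf J with hY
  rcases Y.eq_empty_or_nonempty with h | ⟨y₀, hy₀⟩
  · simp [h]
  have hΔ : (0 : ℝ) < Δ := by
    exact_mod_cast (Finset.card_pos.mpr ⟨y₀, by simp [hy₀]⟩).trans_le (hb y₀ hy₀)
  have h0 : ∀ y ∈ Y, ∑ i, y i = 0 := fun y hy => (mem_cyclesOf.mp hy).2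
  let P : Finset ι := {a, b}
  let Q : Finset ι := {a, c}
  have hP : ∀ y : ι → V, ∑ i ∈ P, y i = y a + y b := fun y => Finset.sum_pair hab
  have hQ : ∀ y : ι → V, ∑ i ∈ Q, y i = y a + y c := fun y => Finset.sum_pair hac
  let deg : Finset ι → (ι → V) → ℕ := fun R y => (Y.filter fun z => ∀ i ∈ R, z i = y i).card
  have hdeg : ∀ R, ∀ y ∈ Y, (0 : ℝ) < deg R y := fun R y hy => by
    exact_mod_cast Finset.card_pos.mpr ⟨y, by simp [hy]⟩
  let n : ι → (ι → V) → ℕ := fun e y => (Y.filter fun z => z a + z e = y a + y e).card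
  have hn : ∀ e, ∀ y ∈ Y, (0 : ℝ) < n e y := fun e y hy => by
    exact_mod_cast Finset.card_pos.mpr ⟨y, by simp [hy]⟩
  have h1 : ∑ y ∈ Y, deg P y * deg Qᶜ y ≤ Y.card * Δ := by
    refine sum_card_agree_mul_card_agree_le h0 (b := b) (j := c) (by simp [P])
      (by simp [Q, hab.symm, hbc]) (fun i hi => ?_) hb
    simp only [P, Q, Finset.mem_compl, Finset.mem_insert, Finset.mem_singleton]
    tauto
  have h2 : ∑ y ∈ Y, deg Pᶜ y * deg Q y ≤ Y.card * Δ := by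
    refine sum_card_agree_mul_card_agree_le h0 (b := c) (j := b)
      (by simp [P, hac.symm, hbc.symm]) (by simp [Q]) (fun i hi => ?_) hc
    simp only [P, Q, Finset.mem_compl, Finset.mem_insert, Finset.mem_singleton]
    tauto
  have h1' : ∑ y ∈ Y, (deg P y * deg Qᶜ y : ℝ) ≤ Y.card * Δ := by exact_mod_cast h1
  have h2' : ∑ y ∈ Y, (deg Pᶜ y * deg Q y : ℝ) ≤ Y.card * Δ := by exact_mod_cast h2
  have hpt : ∀ y ∈ Y, (4 : ℝ) ≤ (deg P y * deg Qᶜ y + deg Pᶜ y * deg Q y) / Δ +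
      Δ * (1 / n b y + 1 / n c y) := fun y hy => by
    refine four_le_of_mul_le (hdeg _ y hy) (hdeg _ y hy) (hdeg _ y hy) (hdeg _ y hy) (hn b y hy)
      (hn c y hy) hΔ ?_ ?_
    · have := card_fiber_le_card_agree_mul_card_agree hy P
      simp only [hP] at this
      exact_mod_cast this
    · have := card_fiber_le_card_agree_mul_card_agree hy Q
      simp only [hQ] at this
      exact_mod_cast this
  have hsum := Finset.sum_le_sum hpt
  rw [Finset.sum_const, nsmul_eq_mul, Finset.sum_add_distrib, ← Finset.sum_div,
    ← Finset.mul_sum, Finset.sum_add_distrib, Finset.sum_add_distrib,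
    sum_inv_card_fiber Y fun y => y a + y b, sum_inv_card_fiber Y fun y => y a + y c] at hsum
  have hdiv : (∑ y ∈ Y, (deg P y * deg Qᶜ y : ℝ) + ∑ y ∈ Y, (deg Pᶜ y * deg Q y : ℝ)) / Δ ≤
      2 * Y.card := by
    rw [div_le_iff₀ hΔ]
    linarith
  have : (2 : ℝ) * Y.card ≤ Δ * ((Y.image fun y => y a + y b).card +
      (Y.image fun y => y a + y c).card) := by linarith
  exact_mod_cast this

/-- At a minimizer there is a large matching of cycles with distinct sums over some pair of
coordinates. -/
lemma IsMatching.exists_matching_injOn_add {A : ℕ} (hA : 1 ≤ A) {J : Finset (ι → V)}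
    (hJ : IsMatching J) (hne : J.Nonempty)
    (hmin : ∀ J' ⊆ J, J'.Nonempty →
      (cyclesOf J).card * J'.card ^ A ≤ (cyclesOf J').card * J.card ^ A)
    {a b c : ι} (hab : a ≠ b) (hac : a ≠ c) (hbc : b ≠ c) :
    ∃ e, a ≠ e ∧ ∃ C ⊆ cyclesOf J, IsMatching C ∧
      Set.InjOn (fun y => y a + y e) (C : Set (ι → V)) ∧
      J.card ≤ 4 * Fintype.card ι * (A * 2 ^ A) * C.card := by
  have : Nonempty ι := ⟨a⟩
  have h0 : ∀ y ∈ cyclesOf J, ∑ i, y i = 0 := fun y hy => (mem_cyclesOf.mp hy).2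
  by_contra! hcon
  have key : ∀ e, ∃ C ⊆ cyclesOf J, IsMatching C ∧
      Set.InjOn (fun y => y a + y e) (C : Set (ι → V)) ∧
      ∀ y ∈ cyclesOf J, (∀ i, ∀ d ∈ C, d i ≠ y i) → ∃ d ∈ C, d a + d e = y a + y e :=
    fun e => exists_maximal_matching h0 fun y => y a + y e
  obtain ⟨C₁, hC₁, hM₁, hi₁, hmax₁⟩ := key b
  obtain ⟨C₂, hC₂, hM₂, hi₂, hmax₂⟩ := key c
  have hs₁ := hcon b hab C₁ hC₁ hM₁ hi₁
  have hs₂ := hcon c hac C₂ hC₂ hM₂ hi₂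
  set T := (cyclesOf J).card with hT
  set m := J.card with hm
  set k := Fintype.card ι with hk
  have hk1 : 1 ≤ k := Fintype.card_pos
  have hA2 : 1 ≤ A * 2 ^ A := Nat.mul_pos hA (by positivity)
  set R := J.filter fun c => ∃ i, ∃ d ∈ C₁ ∪ C₂, d i = c i with hR
  have hRcard : R.card ≤ k * (C₁.card + C₂.card) :=
    (hJ.card_filter_meets_le _).trans (Nat.mul_le_mul_left _ (Finset.card_union_le _ _))
  set J' := J \ R with hJ'
  have hJ'J : J' ⊆ J := Finset.sdiff_subset
  have hcard : J'.card + R.card = m := Finset.card_sdiff_add_card_eq_card (Finset.filter_subset _ _)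
  have hRm : 2 * R.card ≤ m := by
    have e1 : k * C₁.card ≤ k * C₁.card * (A * 2 ^ A) := Nat.le_mul_of_pos_right _ hA2
    have e2 : k * C₂.card ≤ k * C₂.card * (A * 2 ^ A) := Nat.le_mul_of_pos_right _ hA2
    nlinarith
  have hmpos : 0 < m := hne.card_pos
  have hJ'ne : J'.Nonempty := Finset.card_pos.mp (by omega)
  have hTpos : 0 < T := (hne.mono hJ.subset_cyclesOf).card_pos
  have hsep : ∀ y ∈ cyclesOf J', ∀ i, ∀ d ∈ C₁ ∪ C₂, d i ≠ y i := by
    intro y hy i d hd h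
    obtain ⟨c', hc', hc'i⟩ := (mem_cyclesOf.mp hy).1 i
    obtain ⟨hc'J, hc'R⟩ := Finset.mem_sdiff.mp hc'
    exact hc'R (Finset.mem_filter.mpr ⟨hc'J, i, d, hd, h.trans hc'i.symm⟩)
  have himg : ∀ e C, (∀ y ∈ cyclesOf J, (∀ i, ∀ d ∈ C, d i ≠ y i) →
      ∃ d ∈ C, d a + d e = y a + y e) → C ⊆ C₁ ∪ C₂ →
      ((cyclesOf J').image fun y => y a + y e).card ≤ C.card := by
    intro e C hmax hC
    refine (Finset.card_le_card ?_).trans (Finset.card_image_le (s := C) (f := fun y => y a + y e))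
    intro v hv
    obtain ⟨y, hy, rfl⟩ := Finset.mem_image.mp hv
    exact Finset.mem_image.mpr
      (hmax y (cyclesOf_mono hJ'J hy) fun i d hd => hsep y hy i d (hC hd))
  have hdeg : ∀ i, ∀ y ∈ cyclesOf J',
      ((cyclesOf J').filter fun z => z i = y i).card ≤ A * T / m := by
    intro i y hy
    rw [Nat.le_div_iff_mul_le hmpos]
    exact (Nat.mul_le_mul_right _ (Finset.card_le_card
      (Finset.filter_subset_filter _ (cyclesOf_mono hJ'J)))).trans
      (hJ.degree_le hA hmin i (cyclesOf_mono hJ'J hy))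
  have hcount := two_mul_card_cyclesOf_le hab hac hbc (hdeg b) (hdeg c)
  have h1 := himg b C₁ hmax₁ Finset.subset_union_left
  have h2 := himg c C₂ hmax₂ Finset.subset_union_right
  set T' := (cyclesOf J').card with hT'
  have hTT' : T ≤ 2 ^ A * T' := by
    refine Nat.le_of_mul_le_mul_right (c := m ^ A) ?_ (by positivity)
    calc T * m ^ A ≤ T * (2 * J'.card) ^ A := by gcongr; omega
      _ = 2 ^ A * (T * J'.card ^ A) := by rw [mul_pow]; ring
      _ ≤ 2 ^ A * (T' * m ^ A) := Nat.mul_le_mul_left _ (hmin J' hJ'J hJ'ne)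
      _ = _ := by ring
  have h3 : 2 * T' * m ≤ A * T * (C₁.card + C₂.card) :=
    calc 2 * T' * m ≤ (A * T / m * (C₁.card + C₂.card)) * m :=
          Nat.mul_le_mul_right _ (hcount.trans (Nat.mul_le_mul_left _ (Nat.add_le_add h1 h2)))
      _ = (A * T / m * m) * (C₁.card + C₂.card) := by ring
      _ ≤ _ := Nat.mul_le_mul_right _ (Nat.div_mul_le_self _ _)
  have h4 : 2 * m ≤ A * 2 ^ A * (C₁.card + C₂.card) := by
    refine Nat.le_of_mul_le_mul_right (c := T) ?_ hTpos
    calc 2 * m * T ≤ 2 * m * (2 ^ A * T') := Nat.mul_le_mul_left _ hTT'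
      _ = 2 ^ A * (2 * T' * m) := by ring
      _ ≤ 2 ^ A * (A * T * (C₁.card + C₂.card)) := Nat.mul_le_mul_left _ h3
      _ = _ := by ring
  have h5 : A * 2 ^ A * (C₁.card + C₂.card) ≤ k * (A * 2 ^ A * (C₁.card + C₂.card)) :=
    Nat.le_mul_of_pos_left _ hk1
  nlinarith

/-- The pairs of entries of `C` in the coordinates `a`, `b` with sum `v`. -/
noncomputable def pairsWithSum (C : Finset (ι → V)) (a b : ι) (v : V) : Finset (V × V) :=
  ((C.image fun c => c a) ×ˢ C.image fun c => c b).filter fun q => q.1 + q.2 = v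

lemma mul_card_cyclesOf_image_mergeCoords_le {C H : Finset (ι → V)} (hHC : H ⊆ C) {a b : ι}
    (hab : a ≠ b) {ρ : ℝ} (hρ : ∀ c ∈ H, ρ ≤ (pairsWithSum C a b (c a + c b)).card) :
    ρ * (cyclesOf (H.image (mergeCoords a b))).card ≤ (cyclesOf C).card := by
  have hfib : ∀ z ∈ cyclesOf (H.image (mergeCoords a b)),
      ρ ≤ ((cyclesOf C).filter fun y => mergeCoords a b y = z).card := by
    intro z hz
    obtain ⟨hz1, hz2⟩ := mem_cyclesOf.mp hz
    obtain ⟨c', hc', hca⟩ := hz1 ⟨a, hab⟩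
    obtain ⟨c, hc, rfl⟩ := Finset.mem_image.mp hc'
    rw [mergeCoords_self] at hca
    refine (hρ c hc).trans ?_
    rw [hca]
    let g : V × V → ι → V := fun q i => if h : i = b then q.2 else if i = a then q.1 else z ⟨i, h⟩
    have hgb : ∀ q, g q b = q.2 := fun q => by simp [g]
    have hga : ∀ q, g q a = q.1 := fun q => by simp [g, hab]
    have hgi : ∀ q i (h : i ≠ b), i ≠ a → g q i = z ⟨i, h⟩ := fun q i h h' => by simp [g, h, h']
    have hmerge : ∀ q : V × V, q.1 + q.2 = z ⟨a, hab⟩ → mergeCoords a b (g q) = z := by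
      intro q hq
      funext ⟨i, hi⟩
      by_cases hia : i = a
      · subst hia
        rw [mergeCoords_self, hga, hgb, hq]
      · rw [mergeCoords_of_ne _ hia, hgi q i hi hia]
    refine Nat.cast_le.mpr (Finset.card_le_card_of_injOn g (fun q hq => ?_) fun q _ q' _ h => ?_)
    · simp only [pairsWithSum, Finset.coe_filter, Finset.mem_product, Finset.mem_image,
        Set.mem_ofPred_eq] at hq
      obtain ⟨⟨⟨x, hx, hxa⟩, w, hw, hwb⟩, hq⟩ := hq
      simp only [Finset.coe_filter, Set.mem_ofPred_eq, mem_cyclesOf]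
      refine ⟨⟨fun i => ?_, ?_⟩, hmerge q hq⟩
      · by_cases hib : i = b
        · exact ⟨w, hw, by rw [hib, hgb, hwb]⟩
        by_cases hia : i = a
        · exact ⟨x, hx, by rw [hia, hga, hxa]⟩
        obtain ⟨d', hd', hdi⟩ := hz1 ⟨i, hib⟩
        obtain ⟨d, hd, rfl⟩ := Finset.mem_image.mp hd'
        rw [mergeCoords_of_ne _ hia] at hdi
        exact ⟨d, hHC hd, by rw [hgi q i hib hia, hdi]⟩
      · rw [← sum_mergeCoords hab, hmerge q hq, hz2]
    · exact Prod.ext (by rw [← hga q, h, hga]) (by rw [← hgb q, h, hgb])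
  calc ρ * (cyclesOf (H.image (mergeCoords a b))).card
      = ∑ _z ∈ cyclesOf (H.image (mergeCoords a b)), ρ := by
        rw [Finset.sum_const, nsmul_eq_mul, mul_comm]
    _ ≤ ∑ z ∈ cyclesOf (H.image (mergeCoords a b)),
        (((cyclesOf C).filter fun y => mergeCoords a b y = z).card : ℝ) := Finset.sum_le_sum hfib
    _ ≤ _ := by
        rw [← Nat.cast_sum, ← Finset.card_biUnion]
        · exact Nat.cast_le.mpr (Finset.card_le_card
            (Finset.biUnion_subset.mpr fun z _ => Finset.filter_subset _ _))
        · intro z _ z' _ hne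
          refine Finset.disjoint_left.mpr fun y hy hy' => hne ?_
          rw [← (Finset.mem_filter.mp hy).2, (Finset.mem_filter.mp hy').2]

end Cycles

section LowerBound

/-- In a matching with distinct sums over two coordinates, half of these sums are popular. -/
lemma exists_popular_sums (p : ℕ) [Fact p.Prime] :
    ∃ κ : ℝ, 0 < κ ∧ ∀ (ι V : Type) [Fintype ι] [AddCommGroup V] [Fintype V]
      [Module (ZMod p) V] (C : Finset (ι → V)) (a b : ι), IsMatching C →
      Set.InjOn (fun y => y a + y b) (C : Set (ι → V)) →
      ∃ H ⊆ C, C.card ≤ 2 * H.card ∧ ∀ c ∈ H,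
        κ * (C.card / (2 * (Fintype.card V : ℝ))) ^ (1 / cp3 p) * (Fintype.card V : ℝ) ≤
          (pairsWithSum C a b (c a + c b)).card := by
  obtain ⟨κ, hκ, hspan⟩ := exists_schurSpan_lower_bound p
  have hcp := cp3_pos (Fact.out : p.Prime).two_le
  refine ⟨κ, hκ, ?_⟩
  intro ι V _ _ _ _ C a b hC hinj
  have hN : (0 : ℝ) < Fintype.card V := by exact_mod_cast Fintype.card_pos
  set N : ℝ := ((Fintype.card V : ℕ) : ℝ)
  set ρ : ℝ := κ * (C.card / (2 * N)) ^ (1 / cp3 p) * N with hρ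
  let r : (ι → V) → ℕ := fun c => (pairsWithSum C a b (c a + c b)).card
  refine ⟨C.filter fun c => ρ ≤ r c, Finset.filter_subset _ _, ?_,
    fun c hc => (Finset.mem_filter.mp hc).2⟩
  by_contra! hlt
  set L := C.filter fun c => ¬ρ ≤ r c with hL
  have hLC : L ⊆ C := Finset.filter_subset _ _
  have hcard : (C.filter fun c => ρ ≤ r c).card + L.card = C.card :=
    Finset.card_filter_add_card_filter_not _
  have hL2 : C.card < 2 * L.card := by omega
  have hLpos : 0 < L.card := by omega
  have hLR : (0 : ℝ) < L.card := by exact_mod_cast hLpos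
  have hM := hC.mono hLC
  have hpair : Set.InjOn (fun c : ι → V => (c a, c b)) (L : Set (ι → V)) := fun c hc c' hc' h =>
    hM.injOn a hc hc' (Prod.mk.inj h).1
  set D := L.image fun c => (c a, c b) with hD
  have hDcard : D.card = L.card := Finset.card_image_of_injOn hpair
  have hDinj : ∀ f : V × V → V, Set.InjOn (fun c : ι → V => f (c a, c b)) (L : Set (ι → V)) →
      Set.InjOn f (D : Set (V × V)) := by
    intro f hf q hq q' hq' h
    obtain ⟨c, hc, rfl⟩ := Finset.mem_image.mp hq
    obtain ⟨c', hc', rfl⟩ := Finset.mem_image.mp hq'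
    rw [hf hc hc' h]
  have hlow := hspan V D (hDinj _ (hM.injOn a)) (hDinj _ (hM.injOn b))
    (hDinj _ (hinj.mono (Finset.coe_subset.mpr hLC)))
  have hup : (schurSpan D).card ≤ ∑ c ∈ L, r c := by
    refine le_trans (Finset.card_le_card ?_) Finset.card_biUnion_le
    intro q hq
    obtain ⟨h1, h2, h3⟩ := mem_schurSpan.mp hq
    simp only [hD, Finset.image_image, Finset.mem_image, Function.comp_apply] at h1 h2 h3
    obtain ⟨x, hx, hx'⟩ := h1
    obtain ⟨w, hw, hw'⟩ := h2
    obtain ⟨c, hc, hc'⟩ := h3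
    refine Finset.mem_biUnion.mpr ⟨c, hc, ?_⟩
    simp only [pairsWithSum, Finset.mem_filter, Finset.mem_product, Finset.mem_image]
    exact ⟨⟨⟨x, hLC hx, hx'⟩, w, hLC hw, hw'⟩, hc'.symm⟩
  have hlt' : (∑ c ∈ L, r c : ℝ) < L.card * ρ := by
    rw [← nsmul_eq_mul, ← Finset.sum_const]
    refine Finset.sum_lt_sum_of_nonempty (Finset.card_pos.mp hLpos) fun c hc => ?_
    exact not_le.mp (Finset.mem_filter.mp hc).2
  have hchain : κ * (L.card / N) ^ (1 + 1 / cp3 p) * N ^ 2 < L.card * ρ := by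
    rw [hDcard] at hlow
    refine (hlow.trans ?_).trans_lt hlt'
    exact_mod_cast hup
  rw [Real.rpow_add (by positivity), Real.rpow_one] at hchain
  have hmono : ((C.card : ℝ) / (2 * N)) ^ (1 / cp3 p) ≤ (L.card / N) ^ (1 / cp3 p) := by
    refine Real.rpow_le_rpow (by positivity) ?_ (by positivity)
    rw [div_le_div_iff₀ (by positivity) hN]
    have : (C.card : ℝ) < 2 * L.card := by exact_mod_cast hL2
    nlinarith
  have : (L.card : ℝ) * ρ ≤ κ * (L.card / N * (L.card / N) ^ (1 / cp3 p)) * N ^ 2 :=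
    calc (L.card : ℝ) * ρ ≤ L.card * (κ * (L.card / N) ^ (1 / cp3 p) * N) := by
          rw [hρ]
          gcongr
      _ = _ := by field_simp
  linarith

/-- The removal bound for matchings, up to a constant factor. -/
lemma exists_card_cyclesOf_lower_bound (p : ℕ) [Fact p.Prime] (k : ℕ) :
    ∃ κ : ℝ, 0 < κ ∧ ∀ (ι V : Type) [Fintype ι] [AddCommGroup V] [Fintype V]
      [Module (ZMod p) V] (C : Finset (ι → V)), Fintype.card ι = k + 2 → IsMatching C →
      κ * (C.card / (Fintype.card V : ℝ)) ^ (k / cp3 p + 1) * (Fintype.card V : ℝ) ^ (k + 1) ≤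
        (cyclesOf C).card := by
  have hcp := cp3_pos (Fact.out : p.Prime).two_le
  induction k with
  | zero =>
    refine ⟨1, one_pos, ?_⟩
    intro ι V _ _ _ _ C _ hC
    have hN : (0 : ℝ) < Fintype.card V := by exact_mod_cast Fintype.card_pos
    have : (C.card : ℝ) ≤ (cyclesOf C).card := by
      exact_mod_cast Finset.card_le_card hC.subset_cyclesOf
    simpa [hN.ne'] using this
  | succ k ih =>
    obtain ⟨κ₁, hκ₁, hpop⟩ := exists_popular_sums p
    obtain ⟨κ₂, hκ₂, hind⟩ := ih
    set e : ℝ := ((k + 1 : ℕ) : ℝ) / cp3 p + 1 with he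
    have hepos : 0 < e := by positivity
    obtain ⟨A, hA⟩ := exists_nat_ge e
    have hA1 : 1 ≤ A := by exact_mod_cast hepos.trans_le hA
    have hA1' : (1 : ℝ) ≤ A := by exact_mod_cast hA1
    set K : ℝ := 4 * (k + 3) * (A * 2 ^ A) with hK
    have hKpos : 0 < K := by positivity
    refine ⟨κ₁ * κ₂ * (1 / (2 * K)) ^ e, by positivity, ?_⟩
    intro ι V _ _ _ _ C hι hC
    have hN : (0 : ℝ) < Fintype.card V := by exact_mod_cast Fintype.card_pos
    rcases C.eq_empty_or_nonempty with rfl | hCne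
    · rw [Finset.card_empty, Nat.cast_zero, zero_div, Real.zero_rpow hepos.ne']
      simp
    obtain ⟨J, hJC, hJne, hmin⟩ := exists_minimizer hCne (fun C => (cyclesOf C).card) A
    have hJ := hC.mono hJC
    refine le_of_minimizer (T := fun C => (cyclesOf C).card) hJC hJne
      (hmin C (Finset.Subset.refl _) hCne) hA hN ?_
    obtain ⟨a, b, c, hab, hac, hbc⟩ := Fintype.two_lt_card_iff.mp (by omega : 2 < Fintype.card ι)
    obtain ⟨b, hab, C', hC'J, hC', hinj, hcard⟩ := hJ.exists_matching_injOn_add hA1 hJne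
      (fun J' h => hmin J' (h.trans hJC)) hab hac hbc
    obtain ⟨H, hHC', hHcard, hHpop⟩ := hpop ι V C' a b hC' hinj
    have hmerge := mul_card_cyclesOf_image_mergeCoords_le hHC' hab hHpop
    obtain ⟨hM, hMcard⟩ := (hC'.mono hHC').image_mergeCoords hab
      (hinj.mono (Finset.coe_subset.mpr hHC'))
    have hsub : Fintype.card {i // i ≠ b} = k + 2 := by
      rw [Fintype.card_subtype_compl, Fintype.card_subtype_eq]
      omega
    have hlow := hind _ V _ hsub hM
    rw [hMcard] at hlow
    set N : ℝ := ((Fintype.card V : ℕ) : ℝ)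
    set q : ℝ := J.card / N with hq
    have hJpos : (0 : ℝ) < J.card := by exact_mod_cast hJne.card_pos
    have hqpos : 0 < q := by positivity
    have hJK : (J.card : ℝ) ≤ K * C'.card := by
      rw [hι] at hcard
      have : ((4 * (k + 1 + 2) * (A * 2 ^ A) * C'.card : ℕ) : ℝ) = K * C'.card := by
        push_cast
        rw [hK]
        ring
      rw [← this]
      exact_mod_cast hcard
    have hHcard' : (C'.card : ℝ) ≤ 2 * H.card := by exact_mod_cast hHcard
    have hq1 : 1 / (2 * K) * q ≤ C'.card / (2 * N) := by
      rw [hq, div_mul_div_comm, div_le_div_iff₀ (by positivity) (by positivity)]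
      nlinarith
    have hq2 : 1 / (2 * K) * q ≤ H.card / N := by
      refine hq1.trans ?_
      rw [div_le_div_iff₀ (by positivity) hN]
      nlinarith
    set s := 1 / (2 * K) * q with hs
    have hspos : 0 < s := by positivity
    have hsplit : e = 1 / cp3 p + (k / cp3 p + 1) := by
      rw [he]
      push_cast
      ring
    calc κ₁ * κ₂ * (1 / (2 * K)) ^ e * q ^ e * N ^ (k + 1 + 1)
        = κ₁ * κ₂ * s ^ e * N ^ (k + 1 + 1) := by
          rw [hs, Real.mul_rpow (by positivity) hqpos.le]
          ring
      _ = κ₁ * s ^ (1 / cp3 p) * N * (κ₂ * s ^ (k / cp3 p + 1) * N ^ (k + 1)) := by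
          rw [hsplit, Real.rpow_add hspos]
          ring
      _ ≤ κ₁ * (C'.card / (2 * N)) ^ (1 / cp3 p) * N *
          (κ₂ * (H.card / N) ^ (k / cp3 p + 1) * N ^ (k + 1)) := by gcongr
      _ ≤ κ₁ * (C'.card / (2 * N)) ^ (1 / cp3 p) * N *
          (cyclesOf (H.image (mergeCoords a b))).card := by gcongr
      _ ≤ (cyclesOf C').card := hmerge
      _ ≤ (cyclesOf J).card := Nat.cast_le.mpr (Finset.card_le_card (cyclesOf_subset_cyclesOf hC'J))

variable {ι V : Type} [Fintype ι] [Fintype V]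

/-- The `r`-fold tensor power of a family of tuples. -/
noncomputable def tensorPower (C : Finset (ι → V)) (r : ℕ) : Finset (ι → Fin r → V) :=
  Finset.univ.filter fun y => ∀ s, (fun i => y i s) ∈ C

lemma card_tensorPower (C : Finset (ι → V)) (r : ℕ) : (tensorPower C r).card = C.card ^ r := by
  have h : (Fintype.piFinset fun _ : Fin r => C).card = C.card ^ r := by simp
  rw [← h]
  refine Finset.card_equiv (Equiv.piComm fun _ _ => V) fun y => ?_
  simp only [tensorPower, Finset.mem_filter, Finset.mem_univ, true_and, Fintype.mem_piFinset]
  rfl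

lemma mem_tensorPower {C : Finset (ι → V)} {r : ℕ} {y : ι → Fin r → V} :
    y ∈ tensorPower C r ↔ ∀ s, (fun i => y i s) ∈ C := by
  simp only [tensorPower, Finset.mem_filter, Finset.mem_univ, true_and]

variable [AddCommGroup V]

lemma IsMatching.isMatching_tensorPower {C : Finset (ι → V)} (hC : IsMatching C) (r : ℕ) :
    IsMatching (tensorPower C r) := by
  refine ⟨fun y hy => ?_, fun i y hy z hz h => ?_⟩
  · funext s
    rw [Finset.sum_apply]
    exact hC.sum_eq_zero _ (mem_tensorPower.mp hy s)
  · funext j s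
    exact congrFun (hC.injOn i (mem_tensorPower.mp hy s) (mem_tensorPower.mp hz s)
      (congrFun h s)) j

lemma cyclesOf_tensorPower_subset (C : Finset (ι → V)) (r : ℕ) :
    cyclesOf (tensorPower C r) ⊆ tensorPower (cyclesOf C) r := by
  intro y hy
  obtain ⟨h1, h2⟩ := mem_cyclesOf.mp hy
  refine mem_tensorPower.mpr fun s => mem_cyclesOf.mpr ⟨fun i => ?_, ?_⟩
  · obtain ⟨c, hc, hci⟩ := h1 i
    exact ⟨_, mem_tensorPower.mp hc s, congrFun hci s⟩
  · rw [← Finset.sum_apply, h2]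
    rfl

lemma le_of_forall_mul_pow_le {κ q T : ℝ} (hκ : 0 < κ) (hT : 0 ≤ T)
    (h : ∀ r : ℕ, κ * q ^ r ≤ T ^ r) : q ≤ T := by
  by_contra! hlt
  rcases hT.eq_or_lt with rfl | hT
  · have h1 := h 1
    rw [pow_one, pow_one] at h1
    exact h1.not_gt (mul_pos hκ hlt)
  obtain ⟨r, hr⟩ := pow_unbounded_of_one_lt (1 / κ) ((one_lt_div hT).mpr hlt)
  rw [div_pow, div_lt_div_iff₀ hκ (by positivity)] at hr
  linarith [h r]

/-- The removal bound for matchings. -/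
theorem IsMatching.card_cyclesOf_lower_bound {p : ℕ} [Fact p.Prime] [Module (ZMod p) V] {k : ℕ}
    (hι : Fintype.card ι = k + 2) {C : Finset (ι → V)} (hC : IsMatching C) :
    (C.card / (Fintype.card V : ℝ)) ^ (k / cp3 p + 1) * (Fintype.card V : ℝ) ^ (k + 1) ≤
      (cyclesOf C).card := by
  obtain ⟨κ, hκ, hlow⟩ := exists_card_cyclesOf_lower_bound p k
  refine le_of_forall_mul_pow_le hκ (Nat.cast_nonneg _) fun r => ?_
  have h := hlow ι (Fin r → V) _ hι (hC.isMatching_tensorPower r)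
  rw [card_tensorPower, Fintype.card_fun, Fintype.card_fin, Nat.cast_pow, Nat.cast_pow, ← div_pow,
    mul_assoc] at h
  have hup : ((cyclesOf (tensorPower C r)).card : ℝ) ≤ ((cyclesOf C).card : ℝ) ^ r := by
    have := Finset.card_le_card (cyclesOf_tensorPower_subset C r)
    rw [card_tensorPower] at this
    exact_mod_cast this
  refine le_trans (le_of_eq ?_) (h.trans hup)
  rw [mul_pow, ← pow_mul, ← pow_mul, mul_comm (k + 1) r, ← Real.rpow_natCast _ r,
    ← Real.rpow_natCast _ r, ← Real.rpow_mul (by positivity), ← Real.rpow_mul (by positivity),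
    mul_comm _ (r : ℝ)]

end LowerBound

theorem arithmetic_removal (p : ℕ) [hp : Fact p.Prime] (k : ℕ) (hk : 3 ≤ k)
    (ε δ : ℝ) (hε0 : 0 < ε) (hε1 : ε < 1) (hδ : δ = ε ^ Cconst p k)
    (n : ℕ) (hn : 0 < n) (X : Fin k → Finset (Fin n → ZMod p)) :
    δ * ((p : ℝ) ^ n) ^ (k - 1) ≤ ((cycleSet k X).card : ℝ) ∨
    ∃ E : Fin k → Finset (Fin n → ZMod p),
      (∀ i, E i ⊆ X i ∧ ((E i).card : ℝ) < ε * (p : ℝ) ^ n) ∧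
      cycleSet k (fun i => X i \ E i) = ∅ := by
  have : Nonempty (Fin k) := ⟨⟨0, by omega⟩⟩
  have hmem : ∀ (X : Fin k → Finset (Fin n → ZMod p)) y,
      y ∈ cycleSet k X ↔ (∀ i, y i ∈ X i) ∧ ∑ i, y i = 0 := fun X y => by
    simp only [cycleSet, Finset.mem_filter, Fintype.mem_piFinset]
  obtain ⟨M, hMX, hM, -, hmax⟩ := exists_maximal_matching
    (Y := cycleSet k X) (fun y hy => ((hmem X y).mp hy).2) (fun y => y ⟨0, by omega⟩)
  by_cases hsmall : (M.card : ℝ) < ε * (p : ℝ) ^ n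
  · right
    refine ⟨fun i => M.image fun c => c i, fun i => ⟨?_, ?_⟩, ?_⟩
    · intro v hv
      obtain ⟨c, hc, rfl⟩ := Finset.mem_image.mp hv
      exact ((hmem X c).mp (hMX hc)).1 i
    · exact (Nat.cast_le.mpr Finset.card_image_le).trans_lt hsmall
    · refine Finset.eq_empty_of_forall_notMem fun y hy => ?_
      obtain ⟨h1, h2⟩ := (hmem _ y).mp hy
      have hne : ∀ i, ∀ d ∈ M, d i ≠ y i := fun i d hd h =>
        (Finset.mem_sdiff.mp (h1 i)).2 (Finset.mem_image.mpr ⟨d, hd, h⟩)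
      obtain ⟨d, hd, h⟩ :=
        hmax y ((hmem X y).mpr ⟨fun i => (Finset.mem_sdiff.mp (h1 i)).1, h2⟩) hne
      exact hne _ d hd h
  · left
    rw [not_lt] at hsmall
    have hp2 := hp.out.two_le
    have hcp := cp3_pos hp2
    have hppos : (0 : ℝ) < p := by positivity
    obtain ⟨j, rfl⟩ : ∃ j, k = j + 2 := ⟨k - 2, by omega⟩
    have hlow := hM.card_cyclesOf_lower_bound (p := p) (k := j) (by simp)
    have hcard : ((Fintype.card (Fin n → ZMod p) : ℕ) : ℝ) = (p : ℝ) ^ n := by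
      simp [ZMod.card]
    rw [hcard] at hlow
    have hsub : (cyclesOf M).card ≤ (cycleSet (j + 2) X).card := by
      refine Finset.card_le_card fun y hy => ?_
      obtain ⟨h1, h2⟩ := mem_cyclesOf.mp hy
      refine (hmem X y).mpr ⟨fun i => ?_, h2⟩
      obtain ⟨c, hc, hci⟩ := h1 i
      rw [← hci]
      exact ((hmem X c).mp (hMX hc)).1 i
    have hC : Cconst p (j + 2) = j / cp3 p + 1 := by
      rw [Cconst]
      push_cast
      ring
    have hpow : ε ^ ((j : ℝ) / cp3 p + 1) ≤ (M.card / (p : ℝ) ^ n) ^ ((j : ℝ) / cp3 p + 1) :=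
      Real.rpow_le_rpow hε0.le (by rwa [le_div_iff₀ (by positivity)]) (by positivity)
    rw [hδ, hC, show j + 2 - 1 = j + 1 by omega]
    calc _ ≤ (M.card / (p : ℝ) ^ n) ^ ((j : ℝ) / cp3 p + 1) * ((p : ℝ) ^ n) ^ (j + 1) := by gcongr
      _ ≤ _ := hlow
      _ ≤ _ := Nat.cast_le.mpr hsub
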